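/- Let n = 2m be even. If 0 ≤ l ≤ m−1 and ν is a partition with at most m parts satisfying ν_1 = ⋯ = ν_{l+1}, then H^1_{{0}}(J_{ν,l}) = 0. -/

import Mathlib

/-!
Common setup: the polynomial ring `S = ℂ[x_{i,j}]` of the space
`X = ⋀² (ℂⁿ)*` of `n × n` complex skew-symmetric matrices, Pfaffians, the
`GL_n(ℂ)`-action, invariant ideals, Pfaffian varieties and their (radical)
vanishing ideals, local cohomology (Mathlib's `localCohomology`), the
localization `S_Pf`, 𝒟-module spans in `S_Pf` (via the partial derivatives,
extended to `S_Pf` as derivations), Gaussian binomial coefficients, and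
injective-hull data for `E = E(ℂ)`.
-/

open scoped BigOperators

noncomputable section

namespace SkewLC

/-- Indices `(i,j)` with `i < j`, labelling the variables `x_{i,j}`. -/
abbrev SkewIdx (n : ℕ) := {p : Fin n × Fin n // p.1 < p.2}

/-- `S = Sym(⋀² ℂ^n) ≅ ℂ[x_{i,j} : 1 ≤ i < j ≤ n]`. -/
abbrev PS (n : ℕ) := MvPolynomial (SkewIdx n) ℂ

/-- The `(i,j)` entry of the generic skew-symmetric matrix `(x_{i,j})`. -/
def genEntry (n : ℕ) (i j : Fin n) : PS n :=
  if h : i < j then MvPolynomial.X ⟨(i, j), h⟩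
  else if h' : j < i then - MvPolynomial.X ⟨(j, i), h'⟩
  else 0

/-- The Pfaffian of the principal `2r × 2r` block of the generic skew-symmetric
matrix (zero by convention if `2r > n`):
`Pf_r = (1/(2^r r!)) ∑_σ sign(σ) ∏_i x_{σ(2i-1) σ(2i)}`. -/
def pfBlock (n r : ℕ) : PS n :=
  if h : 2 * r ≤ n then
    (((2 ^ r * r.factorial : ℕ) : ℂ))⁻¹ •
      ∑ σ : Equiv.Perm (Fin (2 * r)),
        (Equiv.Perm.sign σ : ℤ) •
          ∏ i : Fin r,
            genEntry n (Fin.castLE h (σ ⟨2 * i.1, by have := i.isLt; omega⟩))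
              (Fin.castLE h (σ ⟨2 * i.1 + 1, by have := i.isLt; omega⟩))
  else 0

/-- The full `n × n` Pfaffian `Pf` (for `n` even). -/
def pfaffian (n : ℕ) : PS n := pfBlock n (n / 2)

/-- The action of an `n × n` matrix `g` on `S`, sending the generic
skew-symmetric matrix `X` to `g X gᵀ` (on variables,
`x_{ij} ↦ ∑_{a,b} g_{ia} g_{jb} x_{ab}`).  Restricted to invertible `g` this
is the natural action of `GL_n(ℂ)` on `S`. -/
def glMap (n : ℕ) (g : Matrix (Fin n) (Fin n) ℂ) : PS n →ₐ[ℂ] PS n :=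
  MvPolynomial.aeval fun p : SkewIdx n =>
    ∑ a : Fin n, ∑ b : Fin n, (g p.1.1 a * g p.1.2 b) • genEntry n a b

/-- `z : ℕ → ℕ` is a partition with at most `m` nonzero parts, recorded as the
(0-indexed) weakly decreasing sequence `z 0 ≥ z 1 ≥ ⋯`; so `z i` is the
`(i+1)`-st part `z_{i+1}` of the partition. -/
def IsPartition (m : ℕ) (z : ℕ → ℕ) : Prop :=
  (∀ i j, i ≤ j → z j ≤ z i) ∧ ∀ i, m ≤ i → z i = 0

/-- The rectangular partition `a × b` (`a` parts equal to `b`). -/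
def rect (a b : ℕ) : ℕ → ℕ := fun i => if i < a then b else 0

/-- The highest weight vector of the irreducible summand
`𝕊_{z^{(2)}} W ⊆ S`: the product `∏_i Pf_i^{z_i - z_{i+1}}` of powers of the
principal `2i × 2i` Pfaffians. -/
def hwVector (n : ℕ) (z : ℕ → ℕ) : PS n :=
  ∏ i ∈ Finset.range (n / 2), pfBlock n (i + 1) ^ (z i - z (i + 1))

/-- The `GL_n(ℂ)`-invariant ideal `I_z ⊆ S` generated by the irreducible
subrepresentation `𝕊_{z^{(2)}} W` of `S`; since that irreducible is spanned by
the `GL`-orbit of its highest weight vector, `I_z` is the ideal generated by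
the `GL_n(ℂ)`-orbit of `hwVector n z`. -/
def invIdeal (n : ℕ) (z : ℕ → ℕ) : Ideal (PS n) :=
  Ideal.span {f | ∃ g : Matrix.GeneralLinearGroup (Fin n) ℂ,
    f = glMap n g.val (hwVector n z)}

/-- The Pfaffian variety `O̅_k`: skew-symmetric `n × n` matrices of rank `≤ 2k`. -/
def rankVariety (n k : ℕ) : Set (Matrix (Fin n) (Fin n) ℂ) :=
  {A | A.transpose = -A ∧ A.rank ≤ 2 * k}

/-- Evaluation of a polynomial in `S` at a matrix. -/
def evalMat (n : ℕ) (A : Matrix (Fin n) (Fin n) ℂ) : PS n →+* ℂ :=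
  (MvPolynomial.aeval fun p : SkewIdx n => A p.1.1 p.1.2).toRingHom

/-- The (radical) vanishing ideal of the Pfaffian variety `O̅_k`; local
cohomology with support in `O̅_k` is local cohomology at this ideal. -/
def varIdeal (n k : ℕ) : Ideal (PS n) :=
  ⨅ A ∈ rankVariety n k, RingHom.ker (evalMat n A)

/-- The homogeneous maximal ideal `𝔪 ⊆ S` (the vanishing ideal of the origin);
`H^j_{{0}}(-) = H^j_𝔪(-)`. -/
def mIdeal (n : ℕ) : Ideal (PS n) :=
  RingHom.ker (evalMat n 0)

/-- The Gaussian binomial coefficient evaluated at `q^e`,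
`binom(a,b)_{q^e} ∈ ℤ[q] ⊆ ℚ[q]`, where
`binom(a,b)_q = ∏_{i=1}^{b} (1 - q^{a-b+i})/(1 - q^i)`.
(The polynomial division below is exact.) -/
def gaussBinom (a b e : ℕ) : Polynomial ℚ :=
  (∏ i ∈ Finset.range b, (1 - Polynomial.X ^ (e * (a - b + i + 1)))) /
    (∏ i ∈ Finset.range b, (1 - Polynomial.X ^ (e * (i + 1))))

/-- Data exhibiting `E` as the injective hull of `ℂ = S/𝔪` over `S`: an
injective `S`-module together with an essential embedding of `S/𝔪`. -/
structure InjHullData (n : ℕ) where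
  /-- the underlying module -/
  E : Type
  [addCommGroup : AddCommGroup E]
  [module : Module (PS n) E]
  injective : Module.Injective (PS n) E
  emb : (PS n ⧸ mIdeal n) →ₗ[PS n] E
  emb_injective : Function.Injective emb
  essential : ∀ N : Submodule (PS n) E, N ≠ ⊥ → N ⊓ LinearMap.range emb ≠ ⊥

attribute [instance] InjHullData.addCommGroup InjHullData.module

/-- `S_Pf`, the localization of `S` at the Pfaffian. -/
abbrev SPf (n : ℕ) : Type := Localization.Away (pfaffian n)

/-- `Pf⁻¹ ∈ S_Pf`. -/
def pfInv (n : ℕ) : SPf n := IsLocalization.Away.invSelf (S := SPf n) (pfaffian n)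

/-- An `S`-submodule of `S_Pf` is a `𝒟_X`-submodule iff it is stable under the
partial derivatives `∂/∂x_{ij}` (extended to `S_Pf`, as the family `δ`). -/
def DStable (n : ℕ) (δ : SkewIdx n → Derivation ℂ (SPf n) (SPf n))
    (N : Submodule (PS n) (SPf n)) : Prop :=
  ∀ p : SkewIdx n, ∀ x ∈ N, δ p x ∈ N

/-- `⟨v⟩_𝒟 ⊆ S_Pf`, the `𝒟_X`-submodule of `S_Pf` generated by `v`: the
smallest `S`-submodule containing `v` and stable under all partial
derivatives. -/
def dSpan (n : ℕ) (δ : SkewIdx n → Derivation ℂ (SPf n) (SPf n)) (v : SPf n) :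
    Submodule (PS n) (SPf n) :=
  sInf {N : Submodule (PS n) (SPf n) | v ∈ N ∧ DStable n δ N}

/-- The statement that `δ` is the family of partial derivatives `∂/∂x_{ij}` of
`S` extended to derivations of `S_Pf` (such an extension exists and is
unique). -/
def IsDerivExtension (n : ℕ) (δ : SkewIdx n → Derivation ℂ (SPf n) (SPf n)) : Prop :=
  ∀ (p : SkewIdx n) (f : PS n),
    δ p (algebraMap (PS n) (SPf n) f) = algebraMap (PS n) (SPf n) (MvPolynomial.pderiv p f)

/-- For `n = 2m` and `0 ≤ p ≤ m - 1`, the indecomposable equivariant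
`𝒟_X`-module `Q_p = S_Pf / ⟨Pf^{2(p-m+1)}⟩_𝒟 = S_Pf / ⟨Pf^{-2(m-1-p)}⟩_𝒟`. -/
abbrev QMod (n : ℕ) (δ : SkewIdx n → Derivation ℂ (SPf n) (SPf n)) (p : ℕ) :=
  SPf n ⧸ dSpan n δ (pfInv n ^ (2 * (n / 2 - 1 - p)))

/-- The `S`-submodule `𝒩_{k,e} = I_{(m-k) × e} ⊗_S 𝒫_{-e-2k} ⊆ S_Pf`
(`m = n/2`), i.e. the image of the invariant ideal `I_{(m-k) × e}` under
multiplication by `Pf^{-e-2k}`. -/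
def NMod (n k e : ℕ) : Submodule (PS n) (SPf n) :=
  Submodule.map
    ((LinearMap.mulLeft (PS n) (pfInv n ^ (e + 2 * k))).comp
      (Algebra.linearMap (PS n) (SPf n)))
    (invIdeal n (rect (n / 2 - k) e))

/-- The set `succ(z, l, m)` of partitions obtained from `z` by adding boxes in
row `l + 1` or higher (rows recorded 0-indexed: `y i > z i` for some
`l ≤ i < m`). -/
def succSet (m : ℕ) (z : ℕ → ℕ) (l : ℕ) : Set (ℕ → ℕ) :=
  {y | IsPartition m y ∧ (∀ i, z i ≤ y i) ∧ ∃ i, l ≤ i ∧ i < m ∧ z i < y i}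

/-- The ideal `I_{succ(z,l,m)} = ∑_{y ∈ succ(z,l,m)} I_y`. -/
def succIdeal (n : ℕ) (z : ℕ → ℕ) (l : ℕ) : Ideal (PS n) :=
  ⨆ y ∈ succSet (n / 2) z l, invIdeal n y

/-- The subquotient `J_{z,l} = I_z / I_{succ(z,l,m)}` of `S` (`m = n/2`). -/
abbrev JMod (n : ℕ) (z : ℕ → ℕ) (l : ℕ) :=
  ↥(invIdeal n z) ⧸
    Submodule.comap (invIdeal n z : Submodule (PS n) (PS n)).subtype
      (succIdeal n z l : Submodule (PS n) (PS n))

end SkewLC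

namespace SkewLC

section extsec
open CategoryTheory Limits Opposite
universe u
variable {R : Type u} [CommRing R]

theorem ext_map_zero {A A' : ModuleCat.{u} R} (f : A' ⟶ A) (M : ModuleCat.{u} R)
    (H : ∀ (P : ProjectiveResolution A) (Q : ProjectiveResolution A')
      (F : Q.complex ⟶ P.complex), F ≫ P.π = Q.π ≫ (ChainComplex.single₀ _).map f →
      ∀ ζ : P.complex.X 1 ⟶ M, P.complex.d 2 1 ≫ ζ = 0 →
      ∃ η : Q.complex.X 0 ⟶ M, F.f 1 ≫ ζ = Q.complex.d 1 0 ≫ η) :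
    ((Ext R (ModuleCat.{u} R) 1).map f.op).app M = 0 := by
  change ((((linearYoneda R (ModuleCat.{u} R)).obj M).rightOp.leftDerived 1).map f).unop = 0
  set G := ((linearYoneda R (ModuleCat.{u} R)).obj M).rightOp with hG
  let P := projectiveResolution A
  let Q := projectiveResolution A'
  let F := ProjectiveResolution.lift f Q P
  have hF : F ≫ P.π = Q.π ≫ (ChainComplex.single₀ _).map f := ProjectiveResolution.lift_commutes f Q P
  rw [Functor.leftDerived_map_eq G 1 f F hF]
  have key : HomologicalComplex.homologyMap ((G.mapHomologicalComplex _).map F) 1 = 0 := by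
    rw [← cancel_epi (HomologicalComplex.homologyπ _ _), ← cancel_mono (HomologicalComplex.homologyι _ _)]
    simp only [Category.assoc, HomologicalComplex.homologyι_naturality, HomologicalComplex.homology_π_ι_assoc, HomologicalComplex.p_opcyclesMap, comp_zero, zero_comp]
    set K := (G.mapHomologicalComplex (ComplexShape.down ℕ)).obj Q.complex
    set L := (G.mapHomologicalComplex (ComplexShape.down ℕ)).obj P.complex
    apply Quiver.Hom.unop_inj
    have h1 : K.iCycles 1 ≫ K.d 1 0 = 0 := K.iCycles_d 1 0
    have h2 : L.d 2 1 ≫ L.pOpcycles 1 = 0 := L.d_pOpcycles 2 1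
    have h1' := congrArg Quiver.Hom.unop h1
    have h2' := congrArg Quiver.Hom.unop h2
    ext x
    have h2'' := congrArg (fun q => q.hom x) h2'
    obtain ⟨η, hη⟩ := H P Q F hF ((L.pOpcycles 1).unop.hom x) h2''
    have h1'' := congrArg (fun q => q.hom η) h1'
    change (K.iCycles 1).unop.hom (F.f 1 ≫ ((L.pOpcycles 1).unop.hom x)) = 0
    rw [hη]
    exact h1''
  have key' : (G.mapHomologicalComplex (ComplexShape.down ℕ) ⋙
      HomologicalComplex.homologyFunctor (ModuleCat.{u} R)ᵒᵖ (ComplexShape.down ℕ) 1).map F = 0 := key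
  rw [key']
  simp

theorem ext_quot_zero {I I' : Ideal R} (hI : I' ≤ I) (M : ModuleCat.{u} R)
    (f : ModuleCat.of R (R ⧸ I') ⟶ ModuleCat.of R (R ⧸ I))
    (hf : f.hom (Submodule.Quotient.mk 1) = (Submodule.Quotient.mk 1 : R ⧸ I))
    (H : ∀ φ : I →ₗ[R] M, ∃ y : M, ∀ x (hx : x ∈ I'), φ ⟨x, hI hx⟩ = x • y) :
    ((Ext R (ModuleCat.{u} R) 1).map f.op).app M = 0 := by
  apply ext_map_zero
  intro P Q F hF ζ hζ
  -- linear maps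
  let d1 : P.complex.X 1 →ₗ[R] P.complex.X 0 := (P.complex.d 1 0).hom
  let d2 : P.complex.X 2 →ₗ[R] P.complex.X 1 := (P.complex.d 2 1).hom
  let e1 : Q.complex.X 1 →ₗ[R] Q.complex.X 0 := (Q.complex.d 1 0).hom
  let π : P.complex.X 0 →ₗ[R] (R ⧸ I) := (P.π.f 0).hom
  let ρ : Q.complex.X 0 →ₗ[R] (R ⧸ I') := (Q.π.f 0).hom
  let F0 : Q.complex.X 0 →ₗ[R] P.complex.X 0 := (F.f 0).hom
  let F1 : Q.complex.X 1 →ₗ[R] P.complex.X 1 := (F.f 1).hom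
  have hπ : Function.Surjective π := (ModuleCat.epi_iff_surjective (P.π.f 0)).1 inferInstance
  have ex0 : ∀ x, π x = 0 → ∃ e, d1 e = x := (ShortComplex.moduleCat_exact_iff _).1 P.exact₀
  have ex1 : ∀ x, d1 x = 0 → ∃ e, d2 e = x := (ShortComplex.moduleCat_exact_iff _).1 (P.exact_succ 0)
  have hπd : ∀ e, π (d1 e) = 0 := fun e =>
    congrArg (fun q => q.hom e) P.complex_d_comp_π_f_zero
  have hρd : ∀ e, ρ (e1 e) = 0 := fun e =>
    congrArg (fun q => q.hom e) Q.complex_d_comp_π_f_zero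
  have hFπ : ∀ q, π (F0 q) = f.hom (ρ q) := fun q => by
    have h := HomologicalComplex.congr_hom hF 0
    have h' := congrArg (fun g => g.hom q) h
    simp only [HomologicalComplex.comp_f, ChainComplex.single₀_map_f_zero] at h'
    exact h'
  have hFd : ∀ e, d1 (F1 e) = F0 (e1 e) := fun e =>
    congrArg (fun g => g.hom e) (F.comm 1 0)
  have hζ' : ∀ e, ζ.hom (d2 e) = 0 := fun e => congrArg (fun g => g.hom e) hζ
  have hker : LinearMap.ker d1 ≤ LinearMap.ker ζ.hom := by
    intro x hx
    obtain ⟨e, rfl⟩ := ex1 x hx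
    exact hζ' e
  let ζb : LinearMap.range d1 →ₗ[R] M :=
    (LinearMap.ker d1).liftQ ζ.hom hker ∘ₗ d1.quotKerEquivRange.symm.toLinearMap
  have hζb : ∀ e (h : d1 e ∈ LinearMap.range d1), ζb ⟨d1 e, h⟩ = ζ.hom e := by
    intro e h
    have : d1.quotKerEquivRange.symm ⟨d1 e, h⟩ = Submodule.Quotient.mk e := by
      rw [LinearEquiv.symm_apply_eq]; rfl
    simp only [ζb, LinearMap.comp_apply, LinearEquiv.coe_coe, this]
    rfl
  obtain ⟨p0, hp0⟩ := hπ (Submodule.Quotient.mk 1)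
  have hrange : ∀ x, π x = 0 → x ∈ LinearMap.range d1 := fun x hx => ex0 x hx
  have hI0 : ∀ x ∈ I, x • p0 ∈ LinearMap.range d1 := by
    intro x hx
    apply hrange
    rw [map_smul, hp0, ← Submodule.Quotient.mk_smul, Submodule.Quotient.mk_eq_zero]
    simpa using hx
  let φ : I →ₗ[R] M := ζb ∘ₗ
    ((LinearMap.toSpanSingleton R _ p0 ∘ₗ (I : Submodule R R).subtype).codRestrict (LinearMap.range d1)
      (fun x => hI0 x.1 x.2))
  obtain ⟨y, hy⟩ := H φ
  have : Module.Projective R (Q.complex.X 0) := by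
    have : Projective (Q.complex.X 0) := Q.projective 0
    exact (IsProjective.iff_projective (R := R) (P := Q.complex.X 0)).2 this
  obtain ⟨w, hw⟩ := Module.projective_lifting_property (Submodule.mkQ I') ρ (Submodule.mkQ_surjective I')
  have hw' : ∀ q, (Submodule.Quotient.mk (w q) : R ⧸ I') = ρ q := fun q => LinearMap.congr_fun hw q
  have hδ : ∀ q, F0 q - w q • p0 ∈ LinearMap.range d1 := by
    intro q
    apply hrange
    rw [map_sub, hFπ, map_smul, hp0, ← hw' q, ← hf]
    rw [← map_smul, ← map_sub, ← Submodule.Quotient.mk_smul]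
    simp
  let δ : Q.complex.X 0 →ₗ[R] LinearMap.range d1 :=
    (F0 - LinearMap.toSpanSingleton R _ p0 ∘ₗ w).codRestrict (LinearMap.range d1) (fun q => hδ q)
  refine ⟨ModuleCat.ofHom (LinearMap.toSpanSingleton R _ y ∘ₗ w + ζb ∘ₗ δ), ?_⟩
  ext e
  change ζ.hom (F1 e) = w (e1 e) • y + ζb (δ (e1 e))
  have hwI : w (e1 e) ∈ I' := by
    rw [← Submodule.Quotient.mk_eq_zero, hw', hρd]
  rw [← hy _ hwI, ← hζb (F1 e) ⟨_, rfl⟩]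
  change _ = ζb _ + ζb _
  rw [← map_add]
  congr 1
  apply Subtype.ext
  change d1 (F1 e) = w (e1 e) • p0 + (F0 (e1 e) - w (e1 e) • p0)
  rw [hFd]; abel

theorem localCohomology_one_subsingleton (J : Ideal R) (M : ModuleCat.{u} R)
    (H : ∀ (t : ℕ) (φ : (J ^ t : Ideal R) →ₗ[R] M), ∃ y : M, ∀ x (hx : x ∈ J ^ (t + 1)),
      φ ⟨x, Ideal.pow_le_pow_right (Nat.le_succ t) hx⟩ = x • y) :
    Subsingleton ((localCohomology J 1).obj M) := by
  have := localCohomology.hasColimitDiagram.{u, 0} (localCohomology.idealPowersDiagram J) 1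
  set D := localCohomology.diagram (localCohomology.idealPowersDiagram J) 1 with hD
  have hz : ∀ j, (colimit.ι D j).app M = 0 := by
    intro j
    obtain ⟨⟨t⟩⟩ := j
    let g : (op (op t) : (ℕᵒᵖ)ᵒᵖ) ⟶ op (op (t+1)) := (homOfLE (Nat.le_succ t)).op.op
    have h0 : (D.map g).app M = 0 := by
      refine ext_quot_zero (I := J ^ t) (I' := J ^ (t+1)) (Ideal.pow_le_pow_right (Nat.le_succ t)) M
        ((localCohomology.ringModIdeals (localCohomology.idealPowersDiagram J)).map g.unop) rfl (H t)
    have := colimit.w D g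
    rw [← this, NatTrans.comp_app, h0, zero_comp]
  have hc := isColimitOfPreserves ((evaluation _ _).obj M) (colimit.isColimit D)
  have : 𝟙 ((localCohomology J 1).obj M) = 0 := by
    refine hc.hom_ext ?_
    intro j
    change (colimit.ι D j).app M ≫ _ = (colimit.ι D j).app M ≫ _
    rw [hz]; exact zero_comp.trans zero_comp.symm
  exact ModuleCat.subsingleton_of_isZero ((IsZero.iff_id_eq_zero _).2 this)

end extsec

end SkewLC

namespace SkewLC

open MvPolynomial in
theorem coeff_pd {σ : Type*} (i : σ) (h : MvPolynomial σ ℂ) (α : σ →₀ ℕ) :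
    coeff α (pderiv i h) = (α i + 1 : ℂ) * coeff (α + Finsupp.single i 1) h := by
  classical
  induction h using MvPolynomial.induction_on' with
  | monomial u a =>
    rw [pderiv_monomial, coeff_monomial, coeff_monomial]
    by_cases hu : u = α + Finsupp.single i 1
    · subst hu
      simp [mul_comm]
    · rw [if_neg hu]
      split_ifs with h2
      · by_cases hi : u i = 0
        · simp [hi]
        · exfalso; apply hu
          rw [← h2]
          ext j
          by_cases hj : j = i
          · subst hj; simp; omega
          · simp [Finsupp.single_apply, Ne.symm hj]
      · simp
  | add p q hp hq => simp only [map_add, coeff_add, hp, hq, mul_add]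

def facs {σ : Type*} (α : σ →₀ ℕ) : ℕ := α.prod fun _ k => k.factorial

theorem facs_pos {σ : Type*} (α : σ →₀ ℕ) : 0 < facs α :=
  Finset.prod_pos fun _ _ => Nat.factorial_pos _

theorem facs_succ {σ : Type*} (α : σ →₀ ℕ) (i : σ) :
    facs (α + Finsupp.single i 1) = (α i + 1) * facs α := by
  classical
  unfold facs
  have h1 : (α + Finsupp.single i 1).prod (fun _ k => k.factorial) =
      ∏ j ∈ insert i α.support, ((α + Finsupp.single i 1 : σ →₀ ℕ) j).factorial := by
    apply Finsupp.prod_of_support_subset _ _ _ (by simp)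
    intro j hj
    simp only [Finset.mem_insert, Finsupp.mem_support_iff, Finsupp.add_apply] at *
    by_contra hc
    push Not at hc
    simp [hc.2, Finsupp.single_apply, Ne.symm hc.1] at hj
  have h2 : α.prod (fun _ k => k.factorial) = ∏ j ∈ insert i α.support, (α j).factorial :=
    Finsupp.prod_of_support_subset _ (by simp) _ (by simp)
  rw [h1, h2, ← Finset.mul_prod_erase _ _ (Finset.mem_insert_self i _),
    ← Finset.mul_prod_erase (insert i α.support) (fun j => (α j).factorial) (Finset.mem_insert_self i _)]
  rw [← mul_assoc]
  congr 1
  · simp [Nat.factorial_succ]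
  · apply Finset.prod_congr rfl
    intro j hj
    simp [Finsupp.single_apply, Ne.symm (Finset.ne_of_mem_erase hj)]

/-- Fischer form -/
def fis {σ : Type*} (f h : MvPolynomial σ ℂ) : ℂ :=
  ∑ α ∈ f.support, (facs α : ℂ) * (starRingEnd ℂ (f.coeff α)) * h.coeff α

theorem fis_of_subset {σ : Type*} (f h : MvPolynomial σ ℂ) (s : Finset (σ →₀ ℕ)) (hs : f.support ⊆ s) :
    fis f h = ∑ α ∈ s, (facs α : ℂ) * (starRingEnd ℂ (f.coeff α)) * h.coeff α := by
  apply Finset.sum_subset hs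
  intro α _ hα
  simp [MvPolynomial.notMem_support_iff.1 hα]

theorem fis_add_left {σ : Type*} (f f' h : MvPolynomial σ ℂ) : fis (f + f') h = fis f h + fis f' h := by
  classical
  rw [fis_of_subset (f + f') h (f.support ∪ f'.support) MvPolynomial.support_add,
    fis_of_subset f h (f.support ∪ f'.support) Finset.subset_union_left,
    fis_of_subset f' h (f.support ∪ f'.support) Finset.subset_union_right, ← Finset.sum_add_distrib]
  apply Finset.sum_congr rfl
  intros
  simp only [MvPolynomial.coeff_add, map_add]; ring

theorem fis_add_right {σ : Type*} (f h h' : MvPolynomial σ ℂ) : fis f (h + h') = fis f h + fis f h' := by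
  unfold fis
  rw [← Finset.sum_add_distrib]
  simp only [MvPolynomial.coeff_add, mul_add]

theorem fis_smul_right {σ : Type*} (f h : MvPolynomial σ ℂ) (c : ℂ) : fis f (c • h) = c * fis f h := by
  unfold fis
  rw [Finset.mul_sum]
  apply Finset.sum_congr rfl
  intros
  simp only [MvPolynomial.coeff_smul, smul_eq_mul]; ring

theorem fis_symm {σ : Type*} (f h : MvPolynomial σ ℂ) : starRingEnd ℂ (fis h f) = fis f h := by
  classical
  rw [fis_of_subset f h (f.support ∪ h.support) Finset.subset_union_left,
    fis_of_subset h f (f.support ∪ h.support) Finset.subset_union_right, map_sum]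
  apply Finset.sum_congr rfl
  intros
  simp only [map_mul, Complex.conj_conj, map_natCast]; ring

theorem fis_smul_left {σ : Type*} (f h : MvPolynomial σ ℂ) (c : ℂ) :
    fis (c • f) h = starRingEnd ℂ c * fis f h := by
  rw [← fis_symm, fis_smul_right, map_mul, fis_symm]

/-- linear in the second variable -/
def fisL {σ : Type*} (f : MvPolynomial σ ℂ) : MvPolynomial σ ℂ →ₗ[ℂ] ℂ where
  toFun := fis f
  map_add' := fis_add_right f
  map_smul' c h := fis_smul_right f h c

theorem fis_self {σ : Type*} (f : MvPolynomial σ ℂ) :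
    fis f f = ((∑ α ∈ f.support, (facs α : ℝ) * ‖f.coeff α‖ ^ 2 : ℝ) : ℂ) := by
  unfold fis
  push_cast
  apply Finset.sum_congr rfl
  intro α _
  rw [mul_assoc, Complex.conj_mul']

theorem fis_self_eq_zero {σ : Type*} (f : MvPolynomial σ ℂ) (h : fis f f = 0) : f = 0 := by
  rw [fis_self] at h
  norm_cast at h
  rw [Finset.sum_eq_zero_iff_of_nonneg (fun _ _ => by positivity)] at h
  ext α
  by_cases hα : α ∈ f.support
  · have := h α hα
    have h2 := (facs_pos α).ne'
    simpa [h2] using this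
  · simpa using hα

theorem fis_monomial {σ : Type*} (α : σ →₀ ℕ) (c : ℂ) (h : MvPolynomial σ ℂ) :
    fis (MvPolynomial.monomial α c) h = (facs α : ℂ) * (starRingEnd ℂ c) * h.coeff α := by
  classical
  rw [fis_of_subset _ h {α} MvPolynomial.support_monomial_subset]
  simp

theorem fis_mul_X {σ : Type*} (f h : MvPolynomial σ ℂ) (i : σ) :
    fis (f * MvPolynomial.X i) h = fis f (MvPolynomial.pderiv i h) := by
  induction f using MvPolynomial.induction_on' with
  | monomial u a =>
    rw [MvPolynomial.X, MvPolynomial.monomial_mul, fis_monomial, fis_monomial, coeff_pd, facs_succ]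
    push_cast; simp; ring
  | add p q hp hq => rw [add_mul, fis_add_left, hp, hq, fis_add_left]

theorem fis_orth {σ : Type*} (W : Submodule ℂ (MvPolynomial σ ℂ)) [FiniteDimensional ℂ W]
    (f : MvPolynomial σ ℂ) : ∃ a ∈ W, ∀ w ∈ W, fis w (f - a) = 0 := by
  let c : InnerProductSpace.Core ℂ (MvPolynomial σ ℂ) :=
    { inner := fis
      conj_inner_symm := fun x y => fis_symm x y
      re_inner_nonneg := fun x => by
        rw [fis_self]
        simp only [RCLike.re_to_complex, Complex.ofReal_re]
        positivity
      add_left := fun x y z => fis_add_left x y z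
      smul_left := fun x y r => fis_smul_left x y r
      definite := fun x hx => fis_self_eq_zero x hx }
  letI : NormedAddCommGroup (MvPolynomial σ ℂ) := c.toNormedAddCommGroup
  letI : InnerProductSpace ℂ (MvPolynomial σ ℂ) := InnerProductSpace.ofCore c.toCore
  obtain ⟨a, ha, b, hb, hab⟩ := W.exists_add_mem_mem_orthogonal f
  refine ⟨a, ha, fun w hw => ?_⟩
  have := (Submodule.mem_orthogonal W b).1 hb w hw
  rw [hab, add_sub_cancel_left]
  exact this

abbrev MP (n : ℕ) := MvPolynomial (Fin n × Fin n) ℂ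

/-- left translation action -/
def lact {n : ℕ} (g : Matrix (Fin n) (Fin n) ℂ) : MP n →ₐ[ℂ] MP n :=
  MvPolynomial.aeval fun p => ∑ a, MvPolynomial.C (g p.1 a) * MvPolynomial.X (a, p.2)

theorem lact_X {n : ℕ} (g : Matrix (Fin n) (Fin n) ℂ) (p : Fin n × Fin n) :
    lact g (MvPolynomial.X p) = ∑ a, MvPolynomial.C (g p.1 a) * MvPolynomial.X (a, p.2) := by
  simp [lact]

theorem lact_C {n : ℕ} (g : Matrix (Fin n) (Fin n) ℂ) (c : ℂ) :
    lact g (MvPolynomial.C c) = MvPolynomial.C c := by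
  simp [lact, MvPolynomial.algebraMap_eq]

theorem lact_lact {n : ℕ} (g h : Matrix (Fin n) (Fin n) ℂ) (f : MP n) :
    lact g (lact h f) = lact (h * g) f := by
  have : (lact g).comp (lact h) = lact (h * g) := by
    apply MvPolynomial.algHom_ext
    intro p
    simp only [AlgHom.comp_apply, lact_X, map_sum, map_mul, lact_C, Finset.mul_sum, Matrix.mul_apply,
      Finset.sum_mul]
    rw [Finset.sum_comm]
    simp only [mul_assoc]
  exact DFunLike.congr_fun this f

theorem lact_one {n : ℕ} (f : MP n) : lact (1 : Matrix (Fin n) (Fin n) ℂ) f = f := by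
  have : lact (1 : Matrix (Fin n) (Fin n) ℂ) = AlgHom.id ℂ _ := by
    apply MvPolynomial.algHom_ext
    intro p
    simp [lact_X, Matrix.one_apply]
  rw [this]; rfl

theorem pd_lact {n : ℕ} (g : Matrix (Fin n) (Fin n) ℂ) (p : Fin n × Fin n) (h : MP n) :
    MvPolynomial.pderiv p (lact g h) =
      ∑ a, (g a p.1) • lact g (MvPolynomial.pderiv (a, p.2) h) := by
  induction h using MvPolynomial.induction_on with
  | C a => simp [lact_C]
  | add f h hf hh => simp [map_add, hf, hh, Finset.sum_add_distrib]
  | mul_X f q hf =>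
    simp only [map_mul, Derivation.leibniz, hf, lact_X, map_add, smul_eq_mul, smul_add,
      Finset.sum_add_distrib, Finset.mul_sum, map_sum, MvPolynomial.pderiv_C, mul_zero, add_zero]
    congr 1
    · obtain ⟨p1, p2⟩ := p
      obtain ⟨q1, q2⟩ := q
      simp only [MvPolynomial.pderiv_X, Pi.single_apply, Prod.mk.injEq]
      by_cases h2 : q2 = p2
      · subst h2
        simp [apply_ite (lact g), MvPolynomial.smul_eq_C_mul, mul_comm]
      · simp [h2, Ne.symm h2]
    · simp only [Finset.smul_sum, Finset.sum_mul, mul_smul_comm]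
      rw [Finset.sum_comm]

theorem fis_lact {n : ℕ} (g : Matrix (Fin n) (Fin n) ℂ) (f h : MP n) :
    fis (lact g f) h = fis f (lact g.conjTranspose h) := by
  induction f using MvPolynomial.induction_on generalizing h with
  | C a =>
    rw [lact_C]
    rw [← MvPolynomial.monomial_zero', fis_monomial, fis_monomial]
    congr 1
    have : (MvPolynomial.constantCoeff : MP n →+* ℂ).comp (lact g.conjTranspose).toRingHom = MvPolynomial.constantCoeff := by
      apply MvPolynomial.ringHom_ext
      · intro r; simp [lact_C]
      · intro i; simp [lact_X]
    exact (DFunLike.congr_fun this h).symm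
  | add p q hp hq => rw [map_add, fis_add_left, hp, hq, fis_add_left]
  | mul_X f q hf =>
    rw [fis_mul_X, pd_lact, map_mul, lact_X]
    have e1 : ∀ w : MP n, fis f w = fisL f w := fun _ => rfl
    rw [e1, map_sum, Finset.mul_sum]
    have e2 : ∀ s : Finset (Fin n), fis (∑ a ∈ s, lact g f * (MvPolynomial.C (g q.1 a) * MvPolynomial.X (a, q.2))) h
        = ∑ a ∈ s, fis (lact g f * (MvPolynomial.C (g q.1 a) * MvPolynomial.X (a, q.2))) h := by
      intro s
      induction s using Finset.induction_on with
      | empty => simp [fis]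
      | insert a s ha ih => rw [Finset.sum_insert ha, Finset.sum_insert ha, fis_add_left, ih]
    rw [e2]
    apply Finset.sum_congr rfl
    intro a _
    rw [map_smul, ← e1, ← hf, mul_left_comm, ← MvPolynomial.smul_eq_C_mul, fis_smul_left, fis_mul_X]
    simp [Matrix.conjTranspose_apply]

abbrev Mat (n : ℕ) := Matrix (Fin n) (Fin n) ℂ

def Stable {n : ℕ} (N : Submodule ℂ (MP n)) : Prop :=
  ∀ g : Mat n, IsUnit g.det → ∀ f ∈ N, lact g f ∈ N

def IsLower {n : ℕ} (b : Mat n) : Prop := (∀ i j, i < j → b i j = 0) ∧ ∀ i, b i i ≠ 0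

theorem IsLower.det {n : ℕ} {b : Mat n} (hb : IsLower b) : IsUnit b.det := by
  rw [Matrix.det_of_lowerTriangular b (fun i j h => hb.1 i j h), isUnit_iff_ne_zero]
  exact Finset.prod_ne_zero_iff.2 fun i _ => hb.2 i

theorem isLower_diagonal {n : ℕ} (τ : Fin n → ℂ) (h : ∀ i, τ i ≠ 0) :
    IsLower (Matrix.diagonal τ) :=
  ⟨fun i j hij => Matrix.diagonal_apply_ne _ hij.ne, fun i => by simpa using h i⟩

theorem isLower_one {n : ℕ} : IsLower (1 : Mat n) := by
  refine ⟨fun i j hij => Matrix.one_apply_ne hij.ne, fun i => by simp⟩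

def IsHW {n : ℕ} (v : MP n) (a : Fin n → ℕ) : Prop :=
  v ≠ 0 ∧ Antitone a ∧ ∀ b : Mat n, IsLower b → lact b v = (∏ i, b i i ^ a i) • v

/-- row weight -/
def rw1 (n : ℕ) : Fin n × Fin n → (Fin n →₀ ℕ) := fun p => Finsupp.single p.1 1

abbrev wtt {n : ℕ} (α : (Fin n × Fin n) →₀ ℕ) : Fin n →₀ ℕ := Finsupp.weight (rw1 n) α

theorem lact_diag_monomial {n : ℕ} (τ : Fin n → ℂ) (α : (Fin n × Fin n) →₀ ℕ) (c : ℂ) :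
    lact (Matrix.diagonal τ) (MvPolynomial.monomial α c) =
      (∏ i, τ i ^ wtt α i) • MvPolynomial.monomial α c := by
  have key : lact (Matrix.diagonal τ) (MvPolynomial.monomial α 1) =
      (∏ i, τ i ^ wtt α i) • MvPolynomial.monomial α 1 := by
    induction α using Finsupp.induction_linear with
    | zero => simp
    | add f g hf hg =>
      have : (MvPolynomial.monomial (f + g) 1 : MP n) =
        MvPolynomial.monomial f 1 * MvPolynomial.monomial g 1 := by simp [MvPolynomial.monomial_mul]
      rw [this, map_mul, hf, hg, smul_mul_smul_comm, ← Finset.prod_mul_distrib]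
      simp [pow_add, map_add]
    | single p k =>
      have : (MvPolynomial.monomial (Finsupp.single p k) 1 : MP n) = MvPolynomial.X p ^ k := by
        rw [MvPolynomial.X_pow_eq_monomial]
      rw [this, map_pow, lact_X]
      have h2 : ∑ a, MvPolynomial.C (Matrix.diagonal τ p.1 a) * MvPolynomial.X (a, p.2)
          = τ p.1 • (MvPolynomial.X p : MP n) := by
        rw [Finset.sum_eq_single p.1]
        · simp [MvPolynomial.smul_eq_C_mul]
        · intro a _ ha
          simp [Matrix.diagonal_apply_ne _ (Ne.symm ha)]
        · simp
      rw [h2, smul_pow]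
      congr 1
      rw [Finset.prod_eq_single p.1]
      · simp [rw1, Finsupp.weight_single]
      · intro a _ ha
        simp [rw1, Finsupp.weight_single, Finsupp.single_apply, Ne.symm ha]
      · simp
  have : (MvPolynomial.monomial α c : MP n) = c • MvPolynomial.monomial α 1 := by
    simp [MvPolynomial.smul_monomial]
  rw [this, map_smul, key, smul_comm]

theorem lact_diag_wh {n : ℕ} (τ : Fin n → ℂ) (v : MP n) (μ : Fin n →₀ ℕ)
    (hv : MvPolynomial.IsWeightedHomogeneous (rw1 n) v μ) :
    lact (Matrix.diagonal τ) v = (∏ i, τ i ^ μ i) • v := by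
  conv_lhs => rw [v.as_sum]
  conv_rhs => rw [v.as_sum]
  rw [map_sum, Finset.smul_sum]
  apply Finset.sum_congr rfl
  intro α hα
  rw [lact_diag_monomial]
  have := hv (MvPolynomial.mem_support_iff.1 hα)
  rw [wtt, this]

theorem comp_mem {n : ℕ} (N : Submodule ℂ (MP n)) (hN : Stable N) (f : MP n) (hf : f ∈ N)
    (μ : Fin n →₀ ℕ) : MvPolynomial.weightedHomogeneousComponent (rw1 n) μ f ∈ N := by
  classical
  by_contra hc
  obtain ⟨ψ, hψ1, hψ2⟩ := Submodule.exists_le_ker_of_notMem hc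
  set q : MvPolynomial (Fin n) ℂ :=
    ∑ α ∈ f.support, MvPolynomial.monomial (wtt α) (ψ (MvPolynomial.monomial α (f.coeff α))) with hq
  have h1 : ∀ τ : Fin n → ℂ, (∀ i, τ i ≠ 0) → MvPolynomial.eval τ q = 0 := by
    intro τ hτ
    have : ψ (lact (Matrix.diagonal τ) f) = 0 :=
      hψ2 (hN _ (isLower_diagonal τ hτ).det f hf)
    rw [← this]
    conv_rhs => rw [f.as_sum]
    rw [hq, map_sum, map_sum, map_sum]
    apply Finset.sum_congr rfl
    intro α _
    rw [lact_diag_monomial, map_smul, MvPolynomial.eval_monomial, smul_eq_mul, mul_comm,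
      Finsupp.prod_fintype _ _ (by simp)]
  have h2 : q = 0 := by
    have : q * ∏ i, MvPolynomial.X i = 0 := by
      apply MvPolynomial.funext
      intro τ
      rw [map_mul, map_prod, map_zero]
      by_cases h : ∀ i, τ i ≠ 0
      · rw [h1 τ h, zero_mul]
      · push Not at h
        obtain ⟨i, hi⟩ := h
        rw [Finset.prod_eq_zero (Finset.mem_univ i) (by simpa using hi), mul_zero]
    rcases mul_eq_zero.1 this with h | h
    · exact h
    · exact absurd h (Finset.prod_ne_zero_iff.2 fun i _ => MvPolynomial.X_ne_zero i)
  apply hψ1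
  have h3 : q.coeff μ = 0 := by rw [h2]; simp
  rw [← h3, hq, MvPolynomial.coeff_sum, MvPolynomial.weightedHomogeneousComponent_apply, map_sum,
    Finset.sum_filter]
  apply Finset.sum_congr rfl
  intro α _
  rw [MvPolynomial.coeff_monomial]

theorem comp_ne {n : ℕ} (f : MP n) (hf : f ≠ 0) : ∃ α, f.coeff α ≠ 0 ∧
    MvPolynomial.weightedHomogeneousComponent (rw1 n) (wtt α) f ≠ 0 := by
  classical
  obtain ⟨α, hα⟩ := MvPolynomial.ne_zero_iff.1 hf
  refine ⟨α, hα, fun h => hα ?_⟩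
  have := MvPolynomial.coeff_weightedHomogeneousComponent (w := rw1 n) (wtt α) f α
  rw [h] at this
  simpa using this.symm

def hgt {n : ℕ} : (Fin n →₀ ℕ) →+ ℕ := Finsupp.weight (fun i : Fin n => n - i.1)

def Filt (n k : ℕ) : Submodule ℂ (MP n) where
  carrier := {f | ∀ β, f.coeff β ≠ 0 → k ≤ hgt (wtt β)}
  zero_mem' := by intro β; simp
  add_mem' := by
    intro f g hf hg β h
    by_cases h1 : f.coeff β = 0
    · exact hg β (by simpa [h1] using h)
    · exact hf β h1
  smul_mem' := by
    intro c f hf β h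
    apply hf β
    intro h0
    simp [h0] at h

theorem filt_mul {n j k : ℕ} {f g : MP n} (hf : f ∈ Filt n j) (hg : g ∈ Filt n k) :
    f * g ∈ Filt n (j + k) := by
  classical
  intro β h
  have := MvPolynomial.support_mul f g (MvPolynomial.mem_support_iff.2 h)
  obtain ⟨a, ha, b, hb, rfl⟩ := Finset.mem_add.1 this
  rw [wtt, map_add, map_add]
  exact add_le_add (hf a (MvPolynomial.mem_support_iff.1 ha)) (hg b (MvPolynomial.mem_support_iff.1 hb))

theorem filt_mono {n j k : ℕ} (h : j ≤ k) {f : MP n} (hf : f ∈ Filt n k) : f ∈ Filt n j :=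
  fun β hβ => h.trans (hf β hβ)

theorem filt_monomial {n : ℕ} (α : (Fin n × Fin n) →₀ ℕ) (c : ℂ) :
    MvPolynomial.monomial α c ∈ Filt n (hgt (wtt α)) := by
  classical
  intro β h
  rw [MvPolynomial.coeff_monomial] at h
  split_ifs at h with h1
  · rw [h1]
  · exact absurd rfl h

theorem lact_unip {n : ℕ} (b : Mat n) (hb : ∀ i j, i < j → b i j = 0) (hb1 : ∀ i, b i i = 1)
    (α : (Fin n × Fin n) →₀ ℕ) (c : ℂ) :
    lact b (MvPolynomial.monomial α c) - MvPolynomial.monomial α c ∈ Filt n (hgt (wtt α) + 1) := by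
  classical
  have mulstep : ∀ x y : (Fin n × Fin n) →₀ ℕ,
      (lact b (MvPolynomial.monomial x 1) - MvPolynomial.monomial x 1 ∈ Filt n (hgt (wtt x) + 1)) →
      (lact b (MvPolynomial.monomial y 1) - MvPolynomial.monomial y 1 ∈ Filt n (hgt (wtt y) + 1)) →
      (lact b (MvPolynomial.monomial (x + y) 1) - MvPolynomial.monomial (x + y) 1 ∈
        Filt n (hgt (wtt (x + y)) + 1)) := by
    intro x y hx hy
    have e : (MvPolynomial.monomial (x + y) 1 : MP n) =
        MvPolynomial.monomial x 1 * MvPolynomial.monomial y 1 := by simp [MvPolynomial.monomial_mul]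
    have hbx : lact b (MvPolynomial.monomial x 1) ∈ Filt n (hgt (wtt x)) := by
      have := Submodule.add_mem _ (filt_mono (Nat.le_succ _) hx) (filt_monomial x (1 : ℂ))
      simpa using this
    have e2 : lact b (MvPolynomial.monomial (x + y) 1) - MvPolynomial.monomial (x + y) 1 =
      lact b (MvPolynomial.monomial x 1) * (lact b (MvPolynomial.monomial y 1) - MvPolynomial.monomial y 1)
      + (lact b (MvPolynomial.monomial x 1) - MvPolynomial.monomial x 1) * MvPolynomial.monomial y 1 := by
      rw [e, map_mul]; ring
    rw [e2]
    have e3 : hgt (wtt (x + y)) + 1 = hgt (wtt x) + (hgt (wtt y) + 1) := by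
      rw [wtt, map_add, map_add]; ring
    have e4 : hgt (wtt (x + y)) + 1 = (hgt (wtt x) + 1) + hgt (wtt y) := by
      rw [wtt, map_add, map_add]; ring
    apply Submodule.add_mem
    · rw [e3]; exact filt_mul hbx hy
    · rw [e4]; exact filt_mul hx (filt_monomial y 1)
  have hX : ∀ p : Fin n × Fin n, lact b (MvPolynomial.monomial (Finsupp.single p 1) 1) -
      MvPolynomial.monomial (Finsupp.single p 1) 1 ∈ Filt n (hgt (wtt (Finsupp.single p 1)) + 1) := by
    intro p
    have e : (MvPolynomial.monomial (Finsupp.single p 1) 1 : MP n) = MvPolynomial.X p := rfl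
    rw [e, lact_X, ← Finset.add_sum_erase _ _ (Finset.mem_univ p.1), hb1]
    simp only [map_one, one_mul, add_sub_cancel_left]
    apply Submodule.sum_mem
    intro a ha
    rcases lt_or_ge p.1 a with h | h
    · rw [hb _ _ h]; simp
    · have h' : a < p.1 := lt_of_le_of_ne h (Finset.ne_of_mem_erase ha)
      rw [← MvPolynomial.smul_eq_C_mul]
      apply Submodule.smul_mem
      have := filt_monomial (n := n) (Finsupp.single (a, p.2) 1) 1
      refine filt_mono ?_ this
      simp only [wtt, Finsupp.weight_single, rw1, hgt, one_smul]
      have := p.1.isLt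
      have := Fin.lt_def.1 h'
      omega
  have key : lact b (MvPolynomial.monomial α 1) - MvPolynomial.monomial α 1 ∈
      Filt n (hgt (wtt α) + 1) := by
    induction α using Finsupp.induction_linear with
    | zero => simp
    | add f g hf hg => exact mulstep f g hf hg
    | single p k =>
      induction k with
      | zero => simp
      | succ k ih => rw [Finsupp.single_add]; exact mulstep _ _ ih (hX p)
  have e : (MvPolynomial.monomial α c : MP n) = c • MvPolynomial.monomial α 1 := by
    simp [MvPolynomial.smul_monomial]
  rw [e, map_smul, ← smul_sub]
  exact Submodule.smul_mem _ _ key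

theorem lact_unip_wh {n : ℕ} (b : Mat n) (hb : ∀ i j, i < j → b i j = 0) (hb1 : ∀ i, b i i = 1)
    (v : MP n) (μ : Fin n →₀ ℕ)
    (hv : MvPolynomial.IsWeightedHomogeneous (rw1 n) v μ) :
    lact b v - v ∈ Filt n (hgt μ + 1) := by
  have : lact b v - v = ∑ α ∈ v.support, (lact b (MvPolynomial.monomial α (v.coeff α)) -
      MvPolynomial.monomial α (v.coeff α)) := by
    conv_lhs => rw [v.as_sum]
    rw [map_sum, Finset.sum_sub_distrib]
  rw [this]
  apply Submodule.sum_mem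
  intro α hα
  have := hv (MvPolynomial.mem_support_iff.1 hα)
  rw [← this]
  exact lact_unip b hb hb1 α _

theorem lact_perm {n : ℕ} (σ : Equiv.Perm (Fin n)) (f : MP n) :
    lact (σ.permMatrix ℂ) f = MvPolynomial.rename (Prod.map σ id) f := by
  have : lact (σ.permMatrix ℂ) = MvPolynomial.rename (Prod.map σ id) := by
    apply MvPolynomial.algHom_ext
    intro p
    rw [lact_X, MvPolynomial.rename_X, Finset.sum_eq_single (σ p.1)]
    · simp [Equiv.Perm.permMatrix, PEquiv.toMatrix_apply, Prod.map]
    · intro a _ ha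
      simp [Equiv.Perm.permMatrix, PEquiv.toMatrix_apply, Ne.symm ha]
    · simp
  rw [this]

theorem lact_perm_wh {n : ℕ} (σ : Equiv.Perm (Fin n)) (v : MP n) (μ : Fin n →₀ ℕ)
    (hv : MvPolynomial.IsWeightedHomogeneous (rw1 n) v μ) :
    MvPolynomial.IsWeightedHomogeneous (rw1 n) (lact (σ.permMatrix ℂ) v) (μ.mapDomain σ) := by
  intro β hβ
  rw [lact_perm] at hβ
  obtain ⟨α, rfl, hα⟩ := MvPolynomial.coeff_rename_ne_zero _ _ _ hβ
  rw [← hv hα]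
  clear hα hβ
  induction α using Finsupp.induction_linear with
  | zero => simp
  | add f g hf hg => rw [Finsupp.mapDomain_add, map_add, map_add, Finsupp.mapDomain_add, hf, hg]
  | single p k => simp [Finsupp.mapDomain_single, Finsupp.weight_single, rw1, Prod.map]

theorem hgt_eq {n : ℕ} (μ : Fin n →₀ ℕ) : hgt μ = ∑ i, μ i * (n - i.1) := by
  rw [hgt, Finsupp.weight_apply, Finsupp.sum_fintype _ _ (by simp)]
  simp

theorem hgt_wtt_le {n : ℕ} (α : (Fin n × Fin n) →₀ ℕ) : hgt (wtt α) ≤ n * α.degree := by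
  induction α using Finsupp.induction_linear with
  | zero => simp
  | add f g hf hg => rw [map_add, wtt, map_add, map_add, mul_add]; exact add_le_add hf hg
  | single p k =>
    simp only [wtt, rw1, hgt, Finsupp.weight_single, Finsupp.degree_single]
    rw [map_nsmul, Finsupp.weight_single]
    simp only [smul_eq_mul, one_mul]
    rw [mul_comm]
    exact Nat.mul_le_mul_right _ (Nat.sub_le _ _)

theorem hw_exists {n d : ℕ} (N : Submodule ℂ (MP n)) (hN : Stable N) (h0 : N ≠ ⊥)
    (hd : N ≤ MvPolynomial.restrictTotalDegree (Fin n × Fin n) ℂ d) :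
    ∃ v ∈ N, ∃ a, IsHW v a := by
  classical
  let T : Set ℕ := {k | ∃ v ∈ N, v ≠ 0 ∧ ∃ μ, MvPolynomial.IsWeightedHomogeneous (rw1 n) v μ ∧ hgt μ = k}
  have hbd : ∀ k ∈ T, k ≤ n * d := by
    rintro k ⟨v, hv, hv0, μ, hμ, rfl⟩
    obtain ⟨α, hα⟩ := MvPolynomial.ne_zero_iff.1 hv0
    rw [← hμ hα]
    refine (hgt_wtt_le α).trans (Nat.mul_le_mul_left _ ?_)
    have h1 := (MvPolynomial.mem_restrictTotalDegree _ _ _).1 (hd hv)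
    have h2 := MvPolynomial.le_totalDegree (MvPolynomial.mem_support_iff.2 hα)
    exact le_trans h2 h1
  have hcomp : ∀ f ∈ N, f ≠ 0 → ∃ α, f.coeff α ≠ 0 ∧ hgt (wtt α) ∈ T := by
    intro f hf hf0
    obtain ⟨α, hα, h⟩ := comp_ne f hf0
    exact ⟨α, hα, _, comp_mem N hN f hf _, h, _,
      MvPolynomial.weightedHomogeneousComponent_isWeightedHomogeneous _ _, rfl⟩
  obtain ⟨f, hf, hf0⟩ := Submodule.exists_mem_ne_zero_of_ne_bot h0
  have hne : T.Nonempty := by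
    obtain ⟨α, _, h⟩ := hcomp f hf hf0
    exact ⟨_, h⟩
  have hbdd : BddAbove T := ⟨n * d, hbd⟩
  obtain ⟨v, hv, hv0, μ, hμ, hk⟩ := Nat.sSup_mem hne hbdd
  have hmax : ∀ k ∈ T, k ≤ hgt μ := fun k h => hk ▸ le_csSup hbdd h
  refine ⟨v, hv, μ, hv0, ?_, ?_⟩
  · intro i j hij
    rcases hij.eq_or_lt with rfl | hij
    · exact le_rfl
    have hmem : lact ((Equiv.swap i j).permMatrix ℂ) v ∈ N := by
      apply hN _ _ v hv
      rw [Matrix.det_permutation]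
      exact (Units.isUnit _).map (Int.castRingHom ℂ)
    have hnz : lact ((Equiv.swap i j).permMatrix ℂ) v ≠ 0 := by
      rw [lact_perm]
      have hinj : Function.Injective (Prod.map (Equiv.swap i j) (id : Fin n → Fin n)) :=
        (Equiv.injective _).prodMap Function.injective_id
      intro h
      exact hv0 (MvPolynomial.rename_injective _ hinj (h.trans (map_zero _).symm))
    have := hmax _ ⟨_, hmem, hnz, _, lact_perm_wh _ v μ hμ, rfl⟩
    rw [hgt_eq, hgt_eq] at this
    have e : ∀ k, (Finsupp.mapDomain (Equiv.swap i j) μ) k = μ (Equiv.swap i j k) := by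
      intro k
      rw [← Finsupp.equivMapDomain_eq_mapDomain, Finsupp.equivMapDomain_apply, Equiv.symm_swap]
    simp only [e] at this
    rw [← Finset.add_sum_erase _ _ (Finset.mem_univ i),
      ← Finset.add_sum_erase (Finset.univ) (fun x => μ x * (n - x.1)) (Finset.mem_univ i)] at this
    have hji : j ∈ Finset.univ.erase i := Finset.mem_erase.2 ⟨hij.ne', Finset.mem_univ _⟩
    rw [← Finset.add_sum_erase _ _ hji,
      ← Finset.add_sum_erase (Finset.univ.erase i) (fun x => μ x * (n - x.1)) hji] at this
    have e2 : ∑ x ∈ (Finset.univ.erase i).erase j, μ (Equiv.swap i j x) * (n - x.1) =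
        ∑ x ∈ (Finset.univ.erase i).erase j, μ x * (n - x.1) := by
      apply Finset.sum_congr rfl
      intro x hx
      simp only [Finset.mem_erase] at hx
      rw [Equiv.swap_apply_of_ne_of_ne hx.2.1 hx.1]
    rw [e2, Equiv.swap_apply_left, Equiv.swap_apply_right] at this
    by_contra hc
    push Not at hc
    obtain ⟨c, hc⟩ := Nat.exists_eq_add_of_lt hc
    have h3 := Fin.lt_def.1 hij
    have h4 := j.isLt
    obtain ⟨e, he⟩ := Nat.exists_eq_add_of_lt h3
    obtain ⟨r, hr⟩ := Nat.exists_eq_add_of_lt h4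
    have h5 : n - i.1 = r + 1 + e + 1 := by omega
    have h6 : n - j.1 = r + 1 := by omega
    rw [h5, h6, hc] at this
    nlinarith
  · intro b hb
    have hunip : ∀ u : Mat n, (∀ i j, i < j → u i j = 0) → (∀ i, u i i = 1) → lact u v = v := by
      intro u hu hu1
      by_contra hc
      have hne : lact u v - v ≠ 0 := sub_ne_zero.2 hc
      have hmem : lact u v - v ∈ N :=
        N.sub_mem (hN u (IsLower.det ⟨hu, fun i => by simp [hu1 i]⟩) v hv) hv
      obtain ⟨α, hα, hT⟩ := hcomp _ hmem hne
      have h1 := lact_unip_wh u hu hu1 v μ hμ α hα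
      have h2 := hmax _ hT
      omega
    have hbe : b = Matrix.diagonal (fun i => b i i) *
        Matrix.of (fun i j => (b i i)⁻¹ * b i j) := by
      ext i j
      rw [Matrix.diagonal_mul, Matrix.of_apply, mul_inv_cancel_left₀ (hb.2 i)]
    rw [hbe, ← lact_lact, lact_diag_wh _ v μ hμ, map_smul, hunip]
    · simp [hb.2]
    · intro i j hij; simp [hb.1 i j hij]
    · intro i; simp [hb.2 i]

theorem lact_totalDegree {n : ℕ} (g : Mat n) (f : MP n) :
    (lact g f).totalDegree ≤ f.totalDegree := by
  conv_lhs => rw [f.as_sum]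
  rw [map_sum]
  apply MvPolynomial.totalDegree_finsetSum_le
  intro α hα
  refine le_trans ?_ (MvPolynomial.le_totalDegree hα)
  have h1 : (MvPolynomial.monomial α (f.coeff α)).IsHomogeneous (α.degree) :=
    MvPolynomial.isHomogeneous_monomial _ rfl
  have h2 := h1.aeval (fun p => ∑ a, MvPolynomial.C (g p.1 a) * MvPolynomial.X (a, p.2)) (n := 1)
    (fun p => MvPolynomial.IsHomogeneous.sum _ _ _ fun a _ =>
      (by simpa using (MvPolynomial.isHomogeneous_C (Fin n × Fin n) (g p.1 a)).mul (MvPolynomial.isHomogeneous_X ℂ (a, p.2))))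
  have h3 := h2.totalDegree_le
  rw [one_mul] at h3
  exact h3

theorem compl_exists {n : ℕ} (N : Submodule ℂ (MP n)) (hN : Stable N) (f : MP n) :
    ∃ R : Submodule ℂ (MP n), Stable R ∧
      R ≤ MvPolynomial.restrictTotalDegree (Fin n × Fin n) ℂ f.totalDegree ∧
      (∀ x ∈ R, x ∈ N → x = 0) ∧ ∃ a ∈ N, f - a ∈ R := by
  let D := MvPolynomial.restrictTotalDegree (Fin n × Fin n) ℂ f.totalDegree
  have hD : Stable D := by
    intro g _ x hx
    rw [MvPolynomial.mem_restrictTotalDegree] at *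
    exact (lact_totalDegree g x).trans hx
  let R : Submodule ℂ (MP n) :=
    { carrier := {x | x ∈ D ∧ ∀ w ∈ N ⊓ D, fis w x = 0}
      zero_mem' := ⟨D.zero_mem, fun w _ => (fisL w).map_zero⟩
      add_mem' := fun {x y} hx hy => ⟨D.add_mem hx.1 hy.1, fun w hw => by
        rw [fis_add_right, hx.2 w hw, hy.2 w hw, add_zero]⟩
      smul_mem' := fun c x hx => ⟨D.smul_mem c hx.1, fun w hw => by
        rw [fis_smul_right, hx.2 w hw, mul_zero]⟩ }
  have hfin : FiniteDimensional ℂ D := inferInstance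
  have hfin2 : FiniteDimensional ℂ (N ⊓ D : Submodule ℂ (MP n)) :=
    Submodule.finiteDimensional_of_le (inf_le_right : N ⊓ D ≤ D)
  refine ⟨R, ?_, fun x hx => hx.1, ?_, ?_⟩
  · intro g hg x hx
    refine ⟨hD g hg x hx.1, fun w hw => ?_⟩
    have hg' : IsUnit g.conjTranspose.det := by
      rw [Matrix.det_conjTranspose]; exact hg.star
    have := fis_lact g.conjTranspose w x
    rw [Matrix.conjTranspose_conjTranspose] at this
    rw [← this]
    exact hx.2 _ ⟨hN _ hg' w hw.1, hD _ hg' w hw.2⟩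
  · intro x hx hxN
    exact fis_self_eq_zero x (hx.2 x ⟨hxN, hx.1⟩)
  · obtain ⟨a, ha, h⟩ := fis_orth (N ⊓ D) f
    exact ⟨a, ha.1, D.sub_mem ((MvPolynomial.mem_restrictTotalDegree _ _ _).2 le_rfl) ha.2, h⟩

theorem Stable.inf {n : ℕ} {N N' : Submodule ℂ (MP n)} (h : Stable N) (h' : Stable N') :
    Stable (N ⊓ N') := fun g hg f hf => ⟨h g hg f hf.1, h' g hg f hf.2⟩

theorem key_lemma {n : ℕ} (N N' : Submodule ℂ (MP n)) (hN : Stable N) (hN' : Stable N')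
    (H : ∀ v ∈ N, ∀ a, IsHW v a → v ∈ N') : N ≤ N' := by
  intro f hf
  by_contra hc
  obtain ⟨R, hR, hd, hRN, a, ha, hfa⟩ := compl_exists (N ⊓ N') (hN.inf hN') f
  have hne : R ⊓ N ≠ ⊥ := by
    intro h
    have : f - a ∈ R ⊓ N := ⟨hfa, N.sub_mem hf ha.1⟩
    rw [h, Submodule.mem_bot, sub_eq_zero] at this
    exact hc (this ▸ ha.2)
  obtain ⟨v, hv, w, hw⟩ := hw_exists (R ⊓ N) (hR.inf hN) hne (inf_le_left.trans hd)
  exact hw.1 (hRN v hv.1 ⟨hv.2, H v hv.2 w hw⟩)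

section pf
variable {R : Type*} [CommRing R]

def ev0 {k : ℕ} (i : Fin k) : Fin (2 * k) := ⟨2 * i.1, by have := i.isLt; omega⟩
def ev1 {k : ℕ} (i : Fin k) : Fin (2 * k) := ⟨2 * i.1 + 1, by have := i.isLt; omega⟩

def pfs (k : ℕ) (Y : Matrix (Fin (2 * k)) (Fin (2 * k)) R) : R :=
  ∑ σ : Equiv.Perm (Fin (2 * k)), (Equiv.Perm.sign σ : ℤ) •
    ∏ i : Fin k, Y (σ (ev0 i)) (σ (ev1 i))

def pairEquiv (k : ℕ) : Fin k × Fin 2 ≃ Fin (2 * k) where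
  toFun p := ⟨2 * p.1.1 + p.2.1, by have := p.1.isLt; have := p.2.isLt; omega⟩
  invFun s := (⟨s.1 / 2, by have := s.isLt; omega⟩, ⟨s.1 % 2, by omega⟩)
  left_inv p := by
    have := p.2.isLt
    ext
    · simp; omega
    · simp; omega
  right_inv s := by ext; simp; omega

theorem pairEquiv_zero {k : ℕ} (i : Fin k) : pairEquiv k (i, 0) = ev0 i := rfl
theorem pairEquiv_one {k : ℕ} (i : Fin k) : pairEquiv k (i, 1) = ev1 i := rfl

theorem prod_pair {k : ℕ} (f : Fin (2 * k) → R) : ∏ s, f s = ∏ i : Fin k, f (ev0 i) * f (ev1 i) := by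
  rw [← (pairEquiv k).prod_comp, Fintype.prod_prod_type]
  simp [Fin.prod_univ_two, pairEquiv_zero, pairEquiv_one]

def funEquiv (k : ℕ) (ι : Type*) : (Fin (2 * k) → ι) ≃ (Fin k → ι × ι) where
  toFun c i := (c (ev0 i), c (ev1 i))
  invFun f s := if s.1 % 2 = 0 then (f ⟨s.1 / 2, by have := s.isLt; omega⟩).1
    else (f ⟨s.1 / 2, by have := s.isLt; omega⟩).2
  left_inv c := by
    funext s
    simp only
    split_ifs with h
    · congr 1; ext; simp [ev0]; omega
    · congr 1; ext; simp [ev1]; omega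
  right_inv f := by
    funext i
    have h : (2 * i.1 + 1) / 2 = i.1 := by omega
    simp [ev0, ev1, h, Nat.add_mod]

theorem prod_sum_pair {k : ℕ} {ι : Type*} [Fintype ι] [DecidableEq ι] (F : Fin k → ι → ι → R) :
    ∏ i, ∑ a, ∑ b, F i a b = ∑ c : Fin (2 * k) → ι, ∏ i, F i (c (ev0 i)) (c (ev1 i)) := by
  have : ∀ i, ∑ a, ∑ b, F i a b = ∑ p : ι × ι, F i p.1 p.2 := fun i => by
    rw [Fintype.sum_prod_type]
  simp only [this]
  rw [Fintype.prod_sum, ← (funEquiv k ι).sum_comp]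
  rfl

theorem pfs_master {k : ℕ} {ι : Type*} [Fintype ι] [DecidableEq ι]
    (A : Matrix (Fin (2 * k)) ι R) (Y : Matrix ι ι R) :
    pfs k (A * Y * A.transpose) = ∑ c : Fin (2 * k) → ι,
      (∏ i : Fin k, Y (c (ev0 i)) (c (ev1 i))) * (A.submatrix id c).det := by
  have h1 : ∀ p q, (A * Y * A.transpose) p q = ∑ a, ∑ b, A p a * Y a b * A q b := by
    intro p q
    rw [Matrix.mul_apply, Finset.sum_comm]
    apply Finset.sum_congr rfl
    intro b _
    rw [Matrix.mul_apply, Finset.sum_mul]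
    rfl
  unfold pfs
  simp only [h1, prod_sum_pair, Finset.smul_sum, Matrix.det_apply, Finset.mul_sum]
  rw [Finset.sum_comm]
  apply Finset.sum_congr rfl
  intro c _
  apply Finset.sum_congr rfl
  intro σ _
  rw [mul_smul_comm, prod_pair, ← Finset.prod_mul_distrib, Units.smul_def]
  congr 1
  apply Finset.prod_congr rfl
  intro i _
  simp only [Matrix.submatrix_apply, id]
  ring

theorem pfs_congr {k : ℕ} (B Y : Matrix (Fin (2 * k)) (Fin (2 * k)) R) :
    pfs k (B * Y * B.transpose) = B.det * pfs k Y := by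
  have h1 : pfs k Y = pfs k (1 * Y * (1 : Matrix (Fin (2 * k)) (Fin (2 * k)) R).transpose) := by simp
  rw [h1, pfs_master, pfs_master, Finset.mul_sum]
  apply Finset.sum_congr rfl
  intro c _
  have : B.submatrix id c = B * (1 : Matrix (Fin (2 * k)) (Fin (2 * k)) R).submatrix id c := by
    ext i j
    simp [Matrix.mul_apply, Matrix.one_apply]
  rw [this, Matrix.det_mul]
  ring

/-- standard symplectic entries -/
def om (a b : ℕ) : ℤ := if a % 2 = 0 ∧ b = a + 1 then 1 else if b % 2 = 0 ∧ a = b + 1 then -1 else 0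

theorem om_ne {a b : ℕ} (h : om a b ≠ 0) : a / 2 = b / 2 := by
  unfold om at h
  split_ifs at h with h1 h2
  · omega
  · omega
  · exact absurd rfl h

theorem sign_fin2 (κ : Equiv.Perm (Fin 2)) (d : ℕ) :
    om (2 * d + (κ 0).1) (2 * d + (κ 1).1) = (Equiv.Perm.sign κ : ℤ) := by
  have h : κ = 1 ∨ κ = Equiv.swap 0 1 := by
    revert κ; decide
  rcases h with rfl | rfl
  · simp [om]
  · simp [om, Equiv.Perm.sign_swap]

theorem pfs_om_term {k : ℕ} (σ : Equiv.Perm (Fin (2 * k)))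
    (h : ∀ i : Fin k, om (σ (ev0 i)).1 (σ (ev1 i)).1 ≠ 0) :
    (Equiv.Perm.sign σ : ℤ) • ∏ i : Fin k, om (σ (ev0 i)).1 (σ (ev1 i)).1 = 1 := by
  set e := pairEquiv k with he
  set s : Equiv.Perm (Fin k × Fin 2) := (e.trans σ).trans e.symm with hs
  have hsign : Equiv.Perm.sign s = Equiv.Perm.sign σ := by
    have : s = e.symm.permCongr σ := Equiv.ext fun _ => rfl
    rw [this, Equiv.Perm.sign_permCongr]
  have hfst : ∀ i, (s (i, 1)).1 = (s (i, 0)).1 := by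
    intro i
    have := om_ne (h i)
    ext
    simp only [hs, he, Equiv.trans_apply, pairEquiv_zero, pairEquiv_one]
    simp only [pairEquiv, Equiv.coe_fn_symm_mk]
    exact this.symm
  have hfst2 : ∀ i j, (s (i, j)).1 = (s (i, 0)).1 := by
    intro i j
    fin_cases j
    · rfl
    · exact hfst i
  have hsurj : Function.Surjective (fun i => (s (i, 0)).1) := by
    intro j
    obtain ⟨⟨i, x⟩, hx⟩ := s.surjective (j, 0)
    refine ⟨i, ?_⟩
    simp only
    rw [← hfst2 i x, hx]
  have hbij : Function.Bijective (fun i => (s (i, 0)).1) :=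
    ⟨Finite.injective_iff_surjective.2 hsurj, hsurj⟩
  set π : Equiv.Perm (Fin k) := Equiv.ofBijective _ hbij with hπ
  have hπs : ∀ i j, (s (i, j)).1 = π i := fun i j => hfst2 i j
  have hκ : ∀ i, Function.Bijective (fun j => (s (i, j)).2) := by
    intro i
    rw [← Finite.injective_iff_bijective]
    intro j j' hjj
    have : s (i, j) = s (i, j') := Prod.ext (by rw [hπs, hπs]) hjj
    exact (Prod.ext_iff.1 (s.injective this)).2
  set κ : Fin k → Equiv.Perm (Fin 2) := fun i => Equiv.ofBijective _ (hκ i) with hκd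
  have hdec : s = (Equiv.prodCongrLeft (fun _ : Fin 2 => π)) * (Equiv.prodCongrRight κ) := by
    ext1 ⟨i, j⟩
    refine Prod.ext ?_ ?_
    · rw [hπs]; rfl
    · rfl
  have h1 : Equiv.Perm.sign s = ∏ i, Equiv.Perm.sign (κ i) := by
    rw [hdec, map_mul, Equiv.Perm.sign_prodCongrLeft, Equiv.Perm.sign_prodCongrRight,
      Fin.prod_univ_two]
    simp
  rw [← hsign, h1]
  have h2 : ∀ i, om (σ (ev0 i)).1 (σ (ev1 i)).1 = (Equiv.Perm.sign (κ i) : ℤ) := by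
    intro i
    rw [← sign_fin2 (κ i) (π i).1]
    have a0 : ∀ j, (σ (e (i, j))).1 = 2 * (π i).1 + (κ i j).1 := by
      intro j
      have : σ (e (i, j)) = e (s (i, j)) := by simp [hs]
      rw [this, ← hπs i j]
      rfl
    rw [← a0, ← a0]
    rfl
  simp only [h2]
  rw [smul_eq_mul]
  push_cast
  rw [← Finset.prod_mul_distrib]
  apply Finset.prod_eq_one
  intro i _
  rw [← Units.val_mul, Int.units_mul_self, Units.val_one]

theorem pfs_om_pos (k : ℕ) : 0 < pfs k (fun a b => om a.1 b.1) := by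
  unfold pfs
  have h01 : ∀ σ : Equiv.Perm (Fin (2 * k)), 0 ≤ (Equiv.Perm.sign σ : ℤ) •
      ∏ i : Fin k, om (σ (ev0 i)).1 (σ (ev1 i)).1 := by
    intro σ
    by_cases h : ∀ i : Fin k, om (σ (ev0 i)).1 (σ (ev1 i)).1 ≠ 0
    · rw [pfs_om_term σ h]; norm_num
    · push Not at h
      obtain ⟨i, hi⟩ := h
      rw [Finset.prod_eq_zero (Finset.mem_univ i) hi, smul_zero]
  apply Finset.sum_pos' (fun σ _ => h01 σ)
  refine ⟨1, Finset.mem_univ _, ?_⟩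
  rw [pfs_om_term]
  · norm_num
  · intro i
    simp [om, ev0, ev1]

theorem pfs_map {R' : Type*} [CommRing R'] (φ : R →+* R') {k : ℕ} (Y : Matrix (Fin (2 * k)) (Fin (2 * k)) R) :
    φ (pfs k Y) = pfs k (fun a b => φ (Y a b)) := by
  simp [pfs, map_sum, map_prod, map_zsmul]

/-- divisibility -/
theorem pfs_dvd {k m : ℕ} (l : ℕ) (s : R) (A : Matrix (Fin (2 * k)) (Fin (2 * m)) R)
    (Y : Matrix (Fin (2 * m)) (Fin (2 * m)) R)
    (hY : ∀ a b, om a.1 b.1 = 0 → Y a b = 0) (hY2 : ∀ a b : Fin (2 * m), 2 * l ≤ a.1 → s ∣ Y a b) :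
    s ^ (k - l) ∣ pfs k (A * Y * A.transpose) := by
  classical
  rw [pfs_master]
  apply Finset.dvd_sum
  intro c _
  by_cases hinj : Function.Injective c
  · by_cases hz : ∀ i : Fin k, om (c (ev0 i)).1 (c (ev1 i)).1 ≠ 0
    · apply Dvd.dvd.mul_right
      have hd : Function.Injective (fun i : Fin k => (c (ev0 i)).1 / 2) := by
        intro i j hij
        simp only at hij
        have h1 := om_ne (hz i)
        have h2 := om_ne (hz j)
        have e1 : (c (ev0 i)) = (c (ev0 j)) ∨ (c (ev0 i)) = c (ev1 j) := by
          have h3 : c (ev0 j) ≠ c (ev1 j) := fun h => by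
            have := hinj h
            simp [ev0, ev1] at this
          have h3' : (c (ev0 j)).1 ≠ (c (ev1 j)).1 := fun h => h3 (Fin.ext h)
          rw [Fin.ext_iff, Fin.ext_iff]
          omega
        rcases e1 with e1 | e1
        · have := hinj e1
          simp [ev0] at this
          exact Fin.ext this
        · have := hinj e1
          simp [ev0, ev1] at this
          omega
      let T : Finset (Fin k) := Finset.univ.filter fun i => 2 * l ≤ (c (ev0 i)).1
      have hT : k - l ≤ T.card := by
        have h1 : (Tᶜ).card ≤ l := by
          have : (Tᶜ).card = (Tᶜ.image (fun i : Fin k => (c (ev0 i)).1 / 2)).card :=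
            (Finset.card_image_of_injective _ hd).symm
          rw [this]
          calc _ ≤ (Finset.range l).card := by
                apply Finset.card_le_card
                intro x hx
                obtain ⟨i, hi, rfl⟩ := Finset.mem_image.1 hx
                simp [T] at hi
                simp; omega
            _ = l := Finset.card_range l
        have h2 := Finset.card_compl_add_card T
        rw [Fintype.card_fin] at h2
        omega
      refine (pow_dvd_pow s hT).trans ?_
      rw [← Finset.prod_const]
      refine (Finset.prod_dvd_prod_of_dvd _ _ (fun i hi => hY2 _ (c (ev1 i)) (Finset.mem_filter.1 hi).2)).trans ?_
      exact Finset.prod_dvd_prod_of_subset _ _ _ (Finset.subset_univ T)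
    · push Not at hz
      obtain ⟨i, hi⟩ := hz
      rw [Finset.prod_eq_zero (Finset.mem_univ i) (hY _ _ hi), zero_mul]
      exact dvd_zero _
  · rw [Function.Injective] at hinj
    push Not at hinj
    obtain ⟨a, b, hab, hne⟩ := hinj
    rw [Matrix.det_zero_of_column_eq hne (fun i => by simp [hab]), mul_zero]
    exact dvd_zero _
end pf

section sbsec
variable {R : Type*} [CommRing R] [Algebra ℂ R] {n m : ℕ}

def IsSkew (Y : Matrix (Fin n) (Fin n) R) : Prop := ∀ i j, Y i j = - Y j i

theorem IsSkew.tr {Y : Matrix (Fin n) (Fin n) R} (h : IsSkew Y) : Y.transpose = -Y := by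
  ext i j; rw [Matrix.transpose_apply, Matrix.neg_apply]; exact h j i

theorem IsSkew.of_tr {Y : Matrix (Fin n) (Fin n) R} (h : Y.transpose = -Y) : IsSkew Y := by
  intro i j
  have := congrFun (congrFun h j) i
  rwa [Matrix.transpose_apply, Matrix.neg_apply] at this

theorem IsSkew.diag {Y : Matrix (Fin n) (Fin n) R} (h : IsSkew Y) (i : Fin n) : Y i i = 0 := by
  have h1 : Y i i + Y i i = 0 := by
    nth_rewrite 1 [h i i]; simp
  have h2 : (2 : ℂ) • Y i i = 0 := by rw [two_smul]; exact h1
  have h3 := congrArg (fun x => (2⁻¹ : ℂ) • x) h2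
  simpa [smul_smul] using h3

theorem IsSkew.congr {Y : Matrix (Fin n) (Fin n) R} (h : IsSkew Y) (A : Matrix (Fin n) (Fin n) R) :
    IsSkew (A * Y * A.transpose) := by
  apply IsSkew.of_tr
  rw [Matrix.transpose_mul, Matrix.transpose_mul, Matrix.transpose_transpose, h.tr]
  simp [Matrix.mul_assoc]

/-- substitution of a skew matrix -/
def sb (Y : Matrix (Fin n) (Fin n) R) : PS n →ₐ[ℂ] R :=
  MvPolynomial.aeval fun p : SkewIdx n => Y p.1.1 p.1.2

theorem sb_gen {Y : Matrix (Fin n) (Fin n) R} (h : IsSkew Y) (i j : Fin n) :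
    sb Y (genEntry n i j) = Y i j := by
  unfold genEntry sb
  split_ifs with h1 h2
  · simp
  · simp [h i j]
  · have : i = j := le_antisymm (not_lt.1 h2) (not_lt.1 h1)
    subst this
    rw [h.diag, map_zero]

theorem sb_map {R' : Type*} [CommRing R'] [Algebra ℂ R'] (ψ : R →ₐ[ℂ] R')
    (Y : Matrix (Fin n) (Fin n) R) (f : PS n) : ψ (sb Y f) = sb (Y.map ψ) f := by
  unfold sb
  rw [← AlgHom.comp_apply, MvPolynomial.comp_aeval]
  rfl

def genM (n : ℕ) : Matrix (Fin n) (Fin n) (PS n) := Matrix.of fun i j => genEntry n i j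

theorem genM_skew : IsSkew (genM n) := by
  intro i j
  simp only [genM, Matrix.of_apply, genEntry]
  split_ifs with h1 h2 h2
  · exact absurd h1 (not_lt.2 h2.le)
  · simp
  · simp
  · simp

abbrev cm (R : Type*) [CommRing R] [Algebra ℂ R] (g : Matrix (Fin n) (Fin n) ℂ) : Matrix (Fin n) (Fin n) R :=
  g.map (algebraMap ℂ R)

theorem conj_apply {R : Type*} [CommRing R] {ι κ : Type*} [Fintype ι] (A : Matrix κ ι R) (Y : Matrix ι ι R) (p q : κ) :
    (A * Y * A.transpose) p q = ∑ a, ∑ b, A p a * A q b * Y a b := by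
  rw [Matrix.mul_apply, Finset.sum_comm]
  apply Finset.sum_congr rfl
  intro b _
  rw [Matrix.mul_apply, Finset.sum_mul]
  apply Finset.sum_congr rfl
  intro a _
  rw [Matrix.transpose_apply]; ring

theorem sb_glMap {Y : Matrix (Fin n) (Fin n) R} (h : IsSkew Y) (g : Mat n) (f : PS n) :
    sb Y (glMap n g f) = sb (cm R g * Y * (cm R g).transpose) f := by
  have : (sb Y).comp (glMap n g) = sb (cm R g * Y * (cm R g).transpose) := by
    apply MvPolynomial.algHom_ext
    intro p
    simp only [AlgHom.comp_apply, glMap, MvPolynomial.aeval_X, map_sum, map_smul, sb_gen h]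
    simp only [sb, MvPolynomial.aeval_X, conj_apply, Matrix.map_apply, Algebra.smul_def, map_mul]
  exact DFunLike.congr_fun this f

theorem sb_genM (f : PS n) : sb (genM n) f = f := by
  have : sb (genM n) = AlgHom.id ℂ (PS n) := by
    apply MvPolynomial.algHom_ext
    intro p
    simp [sb, genM, genEntry, p.2]
  rw [this]; rfl

theorem glMap_eq (g : Mat n) (f : PS n) :
    glMap n g f = sb (cm (PS n) g * genM n * (cm (PS n) g).transpose) f := by
  rw [← sb_glMap genM_skew, sb_genM]

theorem glMap_glMap (g h : Mat n) (f : PS n) : glMap n g (glMap n h f) = glMap n (h * g) f := by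
  rw [glMap_eq, sb_glMap (genM_skew.congr _), glMap_eq]
  simp [cm, Matrix.map_mul, Matrix.mul_assoc, Matrix.transpose_mul]

theorem glMap_one (f : PS n) : glMap n 1 f = f := by
  have : cm (PS n) (1 : Mat n) = 1 := Matrix.map_one _ (map_zero _) (map_one _)
  rw [glMap_eq, this]
  simp [sb_genM]

theorem evalMat_eq (A : Mat n) (f : PS n) : evalMat n A f = sb A f := rfl

theorem sb_pf {k : ℕ} (hk : 2 * k ≤ n) {Y : Matrix (Fin n) (Fin n) R} (h : IsSkew Y) :
    sb Y (pfBlock n k) = (((2 ^ k * k.factorial : ℕ) : ℂ))⁻¹ •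
      pfs k (Y.submatrix (Fin.castLE hk) (Fin.castLE hk)) := by
  rw [pfBlock, dif_pos hk, map_smul, map_sum]
  congr 1
  apply Finset.sum_congr rfl
  intro σ _
  rw [map_zsmul, map_prod]
  congr 1
  apply Finset.prod_congr rfl
  intro i _
  rw [sb_gen h]
  rfl

theorem sum_castLE {k : ℕ} (hk : k ≤ n) (F : Fin n → R) (hF : ∀ a : Fin n, k ≤ a.1 → F a = 0) :
    ∑ a, F a = ∑ a : Fin k, F (Fin.castLE hk a) := by
  symm
  apply Fintype.sum_of_injective (Fin.castLE hk) (Fin.castLE_injective hk)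
  · intro i hi
    apply hF
    by_contra hc
    exact hi ⟨⟨i.1, not_le.1 hc⟩, rfl⟩
  · intro i; rfl

theorem sb_pf_lower {k : ℕ} (hk : 2 * k ≤ n) {Y : Matrix (Fin n) (Fin n) R} (h : IsSkew Y)
    (b : Matrix (Fin n) (Fin n) R) (hb : ∀ i j, i < j → b i j = 0) :
    sb (b * Y * b.transpose) (pfBlock n k) =
      (∏ i : Fin (2 * k), b (Fin.castLE hk i) (Fin.castLE hk i)) * sb Y (pfBlock n k) := by
  rw [sb_pf hk (h.congr b), sb_pf hk h]
  have e : (b * Y * b.transpose).submatrix (Fin.castLE hk) (Fin.castLE hk) =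
      (b.submatrix (Fin.castLE hk) (Fin.castLE hk)) * (Y.submatrix (Fin.castLE hk) (Fin.castLE hk)) *
      (b.submatrix (Fin.castLE hk) (Fin.castLE hk)).transpose := by
    ext p q
    rw [Matrix.submatrix_apply, conj_apply, conj_apply, sum_castLE hk]
    · apply Finset.sum_congr rfl
      intro a _
      rw [sum_castLE hk]
      · rfl
      · intro c hc
        rw [hb (Fin.castLE hk q) c (by rw [Fin.lt_def]; exact lt_of_lt_of_le q.isLt hc)]
        ring
    · intro c hc
      apply Finset.sum_eq_zero
      intro d _
      rw [hb (Fin.castLE hk p) c (by rw [Fin.lt_def]; exact lt_of_lt_of_le p.isLt hc)]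
      ring
  rw [e, pfs_congr, Matrix.det_of_lowerTriangular]
  · simp
  · intro i j hij
    exact hb _ _ hij

theorem hw_eq (z : ℕ → ℕ) : hwVector (2 * m) z = ∏ k ∈ Finset.range m, pfBlock (2 * m) (k + 1) ^ (z k - z (k + 1)) := by
  rw [hwVector, Nat.mul_div_cancel_left m (by norm_num)]

theorem tele (z : ℕ → ℕ) (hz : ∀ i j, i ≤ j → z j ≤ z i) (j M : ℕ) (hj : j ≤ M) :
    ∑ k ∈ Finset.range M, (if j ≤ k then z k - z (k + 1) else 0) = z j - z M := by
  induction M with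
  | zero => simp; have : j = 0 := by omega
            subst this; omega
  | succ M ih =>
    rw [Finset.sum_range_succ]
    rcases Nat.lt_or_ge M j with h | h
    · have : j = M + 1 := by omega
      subst this
      rw [if_neg (by omega)]
      rw [Finset.sum_eq_zero]
      · omega
      · intro x hx
        rw [if_neg]
        simp at hx; omega
    · rw [ih h, if_pos h]
      have := hz j M h
      have := hz M (M + 1) (by omega)
      omega

theorem tele2 (z : ℕ → ℕ) (hz : ∀ i j, i ≤ j → z j ≤ z i) (l M : ℕ) :
    ∑ k ∈ Finset.range M, (k + 1 - l) * (z k - z (k + 1)) + (M - l) * z M =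
      ∑ k ∈ Finset.range M, if l ≤ k then z k else 0 := by
  induction M with
  | zero => simp
  | succ M ih =>
    rw [Finset.sum_range_succ, Finset.sum_range_succ, ← ih]
    have := hz M (M + 1) (by omega)
    obtain ⟨d, hd⟩ := Nat.exists_eq_add_of_le this
    have h2 : z M - z (M + 1) = d := by omega
    rw [h2, hd]
    split_ifs with h
    · have : M + 1 - l = (M - l) + 1 := by omega
      rw [this]; ring
    · have h1 : M + 1 - l = 0 := by omega
      have h2 : M - l = 0 := by omega
      rw [h1, h2]; ring

theorem sb_hw_lower {Y : Matrix (Fin (2 * m)) (Fin (2 * m)) R} (h : IsSkew Y)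
    (b : Matrix (Fin (2 * m)) (Fin (2 * m)) R) (hb : ∀ i j, i < j → b i j = 0)
    (z : ℕ → ℕ) (hz : IsPartition m z) :
    sb (b * Y * b.transpose) (hwVector (2 * m) z) =
      (∏ i, b i i ^ z (i.1 / 2)) * sb Y (hwVector (2 * m) z) := by
  rw [hw_eq, map_prod, map_prod]
  have h1 : ∀ k ∈ Finset.range m, sb (b * Y * b.transpose) (pfBlock (2 * m) (k + 1) ^ (z k - z (k + 1)))
      = (∏ i : Fin (2 * m), b i i ^ (if i.1 / 2 ≤ k then z k - z (k + 1) else 0)) *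
        sb Y (pfBlock (2 * m) (k + 1) ^ (z k - z (k + 1))) := by
    intro k hk
    have hk' : 2 * (k + 1) ≤ 2 * m := by simp at hk; omega
    rw [map_pow, map_pow, sb_pf_lower hk' h b hb, mul_pow]
    congr 1
    have : ∏ i : Fin (2 * (k + 1)), b (Fin.castLE hk' i) (Fin.castLE hk' i) =
        ∏ i : Fin (2 * m), (if i.1 / 2 ≤ k then b i i else 1) := by
      apply Fintype.prod_of_injective (Fin.castLE hk') (Fin.castLE_injective hk')
      · intro i hi
        rw [if_neg]
        intro hc
        exact hi ⟨⟨i.1, by omega⟩, rfl⟩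
      · intro i
        rw [if_pos]
        simp; omega
    rw [this, ← Finset.prod_pow]
    apply Finset.prod_congr rfl
    intro i _
    split_ifs <;> simp
  rw [Finset.prod_congr rfl h1, Finset.prod_mul_distrib, Finset.prod_comm]
  congr 1
  apply Finset.prod_congr rfl
  intro i _
  rw [Finset.prod_pow_eq_pow_sum, tele z hz.1 _ _ (by omega), hz.2 m le_rfl, Nat.sub_zero]

def omM (m : ℕ) (R : Type*) [CommRing R] : Matrix (Fin (2 * m)) (Fin (2 * m)) R :=
  Matrix.of fun a b => ((om a.1 b.1 : ℤ) : R)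

theorem om_skew (a b : ℕ) : om a b = - om b a := by
  unfold om
  split_ifs <;> first | rfl | omega

theorem omM_skew : IsSkew (omM m R) := by
  intro i j
  simp only [omM, Matrix.of_apply]
  rw [om_skew]; simp

theorem sb_omM_pf {k : ℕ} (hk : k ≤ m) : sb (omM m ℂ) (pfBlock (2 * m) k) ≠ 0 := by
  rw [sb_pf (by omega) omM_skew]
  apply smul_ne_zero
  · apply inv_ne_zero
    have : 0 < 2 ^ k * k.factorial := by positivity
    exact_mod_cast this.ne'
  · have h := pfs_map (Int.castRingHom ℂ) (k := k) (fun a b => om a.1 b.1)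
    have h2 := pfs_om_pos k
    intro h3
    have : (Int.castRingHom ℂ) (pfs k (fun a b => om a.1 b.1)) = 0 := by
      rw [h, ← h3]; rfl
    simp at this
    omega

theorem sb_omM_hw (z : ℕ → ℕ) : sb (omM m ℂ) (hwVector (2 * m) z) ≠ 0 := by
  rw [hw_eq, map_prod]
  apply Finset.prod_ne_zero_iff.2
  intro k hk
  rw [map_pow]
  exact pow_ne_zero _ (sb_omM_pf (by simp at hk; omega))

def omS (m : ℕ) (l : ℕ) (s : R) : Matrix (Fin (2 * m)) (Fin (2 * m)) R :=
  Matrix.of fun a b => ((om a.1 b.1 : ℤ) : R) * if 2 * l ≤ a.1 then s else 1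

theorem omS_eq (l : ℕ) (s : R) : omS m l s =
    Matrix.diagonal (fun i : Fin (2 * m) => if 2 * l ≤ i.1 ∧ i.1 % 2 = 0 then s else 1) * omM m R *
      (Matrix.diagonal (fun i : Fin (2 * m) => if 2 * l ≤ i.1 ∧ i.1 % 2 = 0 then s else 1)).transpose := by
  ext a b
  rw [Matrix.diagonal_transpose, Matrix.mul_diagonal, Matrix.diagonal_mul]
  simp only [omS, omM, Matrix.of_apply, om]
  have ha := a.isLt
  split_ifs <;> first | omega | simp

theorem omS_skew (l : ℕ) (s : R) : IsSkew (omS m l s) := by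
  rw [omS_eq]; exact omM_skew.congr _

theorem sb_omM (f : PS (2 * m)) : sb (omM m R) f = algebraMap ℂ R (sb (omM m ℂ) f) := by
  have := sb_map (Algebra.ofId ℂ R) (omM m ℂ) f
  rw [Algebra.ofId_apply] at this
  rw [this]
  congr 1
  congr 1
  ext i j
  simp [omM]

def tailsum (m l : ℕ) (z : ℕ → ℕ) : ℕ := ∑ k ∈ Finset.range m, if l ≤ k then z k else 0

theorem sb_omS_hw (l : ℕ) (s : R) (z : ℕ → ℕ) (hz : IsPartition m z) :
    sb (omS m l s) (hwVector (2 * m) z) =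
      s ^ tailsum m l z * algebraMap ℂ R (sb (omM m ℂ) (hwVector (2 * m) z)) := by
  rw [omS_eq, sb_hw_lower omM_skew _ _ z hz, sb_omM]
  · congr 1
    rw [prod_pair, tailsum, ← Finset.prod_pow_eq_pow_sum, ← Fin.prod_univ_eq_prod_range
      (fun k => s ^ (if l ≤ k then z k else 0)) m]
    apply Finset.prod_congr rfl
    intro i _
    have h1 : (2 * i.1 + 1) / 2 = i.1 := by omega
    have h2 : 2 * i.1 / 2 = i.1 := by omega
    have h3 : (2 * i.1 + 1) % 2 = 1 := by omega
    simp only [Matrix.diagonal_apply_eq, ev0, ev1, h1, h2, h3]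
    by_cases h : l ≤ i.1
    · simp [h]
    · simp [h]
  · intro i j hij
    exact Matrix.diagonal_apply_ne _ hij.ne

theorem sb_omS_pf_dvd (l k : ℕ) (hk : k ≤ m) (s : R) (A : Matrix (Fin (2 * m)) (Fin (2 * m)) R) :
    s ^ (k - l) ∣ sb (A * omS m l s * A.transpose) (pfBlock (2 * m) k) := by
  have hk' : 2 * k ≤ 2 * m := by omega
  rw [sb_pf hk' ((omS_skew l s).congr A), Algebra.smul_def]
  apply Dvd.dvd.mul_left
  have : (A * omS m l s * A.transpose).submatrix (Fin.castLE hk') (Fin.castLE hk') =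
      (A.submatrix (Fin.castLE hk') id) * omS m l s * (A.submatrix (Fin.castLE hk') id).transpose := by
    ext p q
    rw [Matrix.submatrix_apply, conj_apply, conj_apply]
    rfl
  rw [this]
  apply pfs_dvd
  · intro a b hab
    simp [omS, hab]
  · intro a b hab
    simp [omS, hab]

theorem sb_omS_hw_dvd (l : ℕ) (s : R) (A : Matrix (Fin (2 * m)) (Fin (2 * m)) R) (z : ℕ → ℕ)
    (hz : IsPartition m z) :
    s ^ tailsum m l z ∣ sb (A * omS m l s * A.transpose) (hwVector (2 * m) z) := by
  have h := tele2 z hz.1 l m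
  rw [hz.2 m le_rfl, mul_zero, add_zero] at h
  rw [tailsum, ← h, hw_eq, map_prod, ← Finset.prod_pow_eq_pow_sum]
  apply Finset.prod_dvd_prod_of_dvd
  intro k hk
  rw [map_pow, pow_mul]
  exact pow_dvd_pow_of_dvd (sb_omS_pf_dvd l (k + 1) (by simp at hk; omega) s A) _
end sbsec

theorem IsLower.mul {n : ℕ} {b c : Mat n} (hb : IsLower b) (hc : IsLower c) : IsLower (b * c) := by
  refine ⟨?_, ?_⟩
  · intro i j hij
    rw [Matrix.mul_apply]
    apply Finset.sum_eq_zero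
    intro k _
    rcases lt_or_ge i k with h | h
    · rw [hb.1 i k h, zero_mul]
    · rw [hc.1 k j (lt_of_le_of_lt h hij), mul_zero]
  · intro i
    rw [Matrix.mul_apply, Finset.sum_eq_single i]
    · exact mul_ne_zero (hb.2 i) (hc.2 i)
    · intro k _ hk
      rcases lt_or_gt_of_ne hk with h | h
      · rw [hc.1 k i h, mul_zero]
      · rw [hb.1 i k h, zero_mul]
    · simp

def ZS (m k : ℕ) (X : Mat (2 * m)) : Prop :=
  IsSkew X ∧ ∀ i j : Fin (2 * m), (i.1 < 2 * k ∨ j.1 < 2 * k) → X i j = ((om i.1 j.1 : ℤ) : ℂ)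

theorem om_zero {a b : ℕ} (h : a / 2 ≠ b / 2) : om a b = 0 := by
  by_contra hc; exact h (om_ne hc)

theorem ZS_step (m k : ℕ) (hk : k < m) (X : Mat (2 * m)) (hX : ZS m k X)
    (ha : X ⟨2 * k, by omega⟩ ⟨2 * k + 1, by omega⟩ ≠ 0) :
    ∃ b X', IsLower b ∧ ZS m (k + 1) X' ∧ X = b * X' * b.transpose := by
  obtain ⟨hsk, hX⟩ := hX
  obtain ⟨p0, hp0⟩ : ∃ p : Fin (2 * m), p.1 = 2 * k := ⟨⟨2 * k, by omega⟩, rfl⟩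
  obtain ⟨p1, hp1⟩ : ∃ p : Fin (2 * m), p.1 = 2 * k + 1 := ⟨⟨2 * k + 1, by omega⟩, rfl⟩
  have hp0' : (⟨2 * k, by omega⟩ : Fin (2 * m)) = p0 := Fin.ext hp0.symm
  have hp1' : (⟨2 * k + 1, by omega⟩ : Fin (2 * m)) = p1 := Fin.ext hp1.symm
  rw [hp0', hp1'] at ha
  set a := X p0 p1 with hadef
  set d : Fin (2 * m) → ℂ := fun i => if i = p0 then a else 1 with hd
  set u : Fin (2 * m) → ℂ := fun i => if i.1 ≤ 2 * k + 1 then 0 else X i p1 with hu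
  set w : Fin (2 * m) → ℂ := fun i => if i.1 ≤ 2 * k + 1 then 0 else a⁻¹ * X p0 i with hw
  set X' : Mat (2 * m) := Matrix.of fun i j => if i.1 < 2 * (k + 1) ∨ j.1 < 2 * (k + 1) then
    ((om i.1 j.1 : ℤ) : ℂ) else X i j - u i * w j + w i * u j with hX'
  set b : Mat (2 * m) := Matrix.of fun i p => (if p = i then d i else 0) + (if p = p0 then u i else 0)
    + (if p = p1 then w i else 0) with hb
  have hu0 : ∀ i : Fin (2 * m), i.1 ≤ 2 * k + 1 → u i = 0 := fun i h => by simp [hu, h]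
  have hw0 : ∀ i : Fin (2 * m), i.1 ≤ 2 * k + 1 → w i = 0 := fun i h => by simp [hw, h]
  have hX'sk : IsSkew X' := by
    intro i j
    simp only [hX', Matrix.of_apply]
    by_cases h : i.1 < 2 * (k + 1) ∨ j.1 < 2 * (k + 1)
    · rw [if_pos h, if_pos h.symm, om_skew]; simp
    · rw [if_neg h, if_neg (fun h' => h h'.symm), hsk i j]; ring
  have hX'om : ∀ i j : Fin (2 * m), (i.1 < 2 * (k + 1) ∨ j.1 < 2 * (k + 1)) → X' i j = ((om i.1 j.1 : ℤ) : ℂ) :=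
    fun i j h => by simp only [hX', Matrix.of_apply]; rw [if_pos h]
  have hsum : ∀ (i : Fin (2 * m)) (F : Fin (2 * m) → ℂ), ∑ p, b i p * F p = d i * F i + u i * F p0 + w i * F p1 := by
    intro i F
    simp [hb, add_mul, Finset.sum_add_distrib]
  have hent : ∀ i j, (b * X' * b.transpose) i j =
      d i * (d j * X' i j + u j * X' i p0 + w j * X' i p1) + u i * (d j * X' p0 j + w j)
      + w i * (d j * X' p1 j - u j) := by
    intro i j
    rw [conj_apply]
    have : ∀ p, ∑ q, b i p * b j q * X' p q = b i p * (d j * X' p j + u j * X' p p0 + w j * X' p p1) := by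
      intro p
      rw [← hsum j (fun q => X' p q), Finset.mul_sum]
      apply Finset.sum_congr rfl; intro q _; ring
    simp only [this]
    rw [hsum i]
    have e00 : X' p0 p0 = 0 := hX'sk.diag p0
    have e11 : X' p1 p1 = 0 := hX'sk.diag p1
    have e01 : X' p0 p1 = 1 := by rw [hX'om _ _ (by omega)]; simp [om, hp0, hp1]
    have e10 : X' p1 p0 = -1 := by rw [hX'sk, e01]
    rw [e00, e11, e01, e10]
    ring
  have hd1 : ∀ i : Fin (2 * m), i ≠ p0 → d i = 1 := fun i h => by simp [hd, h]
  have hd0 : d p0 = a := by simp [hd]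
  have hne : p1 ≠ p0 := fun h => by rw [Fin.ext_iff] at h; omega
  refine ⟨b, X', ⟨?_, ?_⟩, ⟨hX'sk, hX'om⟩, ?_⟩
  · intro i j hij
    have h1 := Fin.lt_def.1 hij
    simp only [hb, Matrix.of_apply]
    rw [if_neg hij.ne']
    split_ifs with h2 h3 h3
    · exact absurd (h3.symm.trans h2) hne
    · rw [hu0 i (by rw [h2] at h1; omega)]; simp
    · rw [hw0 i (by rw [h3] at h1; omega)]; simp
    · simp
  · intro i
    simp only [hb, Matrix.of_apply, if_true]
    by_cases h0 : i = p0
    · subst h0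
      rw [if_pos rfl, if_neg hne.symm, hu0 i (by omega), hd0]
      simpa using ha
    · rw [if_neg h0, hd1 i h0]
      split_ifs with h1
      · rw [hw0 i (by rw [h1]; omega)]; simp
      · simp
  · have caseB : ∀ i j : Fin (2 * m), i.1 ≤ 2 * k + 1 → 2 * k + 1 < j.1 → X i j = (b * X' * b.transpose) i j := by
      intro i j hi hj
      have hj0 : j ≠ p0 := fun h => by rw [h] at hj; omega
      rw [hent, hu0 i hi, hw0 i hi, hd1 j hj0, hX'om i j (by omega), hX'om i p0 (by omega),
        hX'om i p1 (by omega), om_zero (a := i.1) (b := j.1) (by omega)]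
      rcases Nat.lt_trichotomy i.1 (2 * k) with h | h | h
      · rw [om_zero (a := i.1) (b := p0.1) (by omega), om_zero (a := i.1) (b := p1.1) (by omega),
          hX i j (by omega), om_zero (by omega)]
        simp
      · have : i = p0 := Fin.ext (by omega)
        subst this
        rw [hd0]
        have e1 : om i.1 i.1 = 0 := by simp [om]
        have e2 : om i.1 p1.1 = 1 := by simp [om, hp0, hp1]
        have e3 : w j = a⁻¹ * X i j := by simp only [hw]; rw [if_neg (by omega)]
        rw [e1, e2, e3]
        simp
        rw [mul_inv_cancel_left₀ ha]
      · have : i = p1 := Fin.ext (by omega)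
        subst this
        rw [hd1 i hne]
        have e1 : om i.1 i.1 = 0 := by simp [om]
        have e2 : om i.1 p0.1 = -1 := by rw [om_skew]; simp [om, hp0, hp1]
        have e3 : u j = X j i := by simp only [hu]; rw [if_neg (by omega)]
        rw [e1, e2, e3, hsk i j]
        simp
    ext i j
    rcases Nat.lt_or_ge (2 * k + 1) i.1 with hi | hi
    · rcases Nat.lt_or_ge (2 * k + 1) j.1 with hj | hj
      · have hi0 : i ≠ p0 := fun h => by rw [h] at hi; omega
        have hj0 : j ≠ p0 := fun h => by rw [h] at hj; omega
        rw [hent, hd1 i hi0, hd1 j hj0, hX'om i p0 (by omega), hX'om i p1 (by omega),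
          hX'om p0 j (by omega), hX'om p1 j (by omega), om_zero (a := i.1) (b := p0.1) (by omega),
          om_zero (a := i.1) (b := p1.1) (by omega), om_zero (a := p0.1) (b := j.1) (by omega),
          om_zero (a := p1.1) (b := j.1) (by omega)]
        have : X' i j = X i j - u i * w j + w i * u j := by
          simp only [hX', Matrix.of_apply]; rw [if_neg (by omega)]
        rw [this]
        push_cast
        ring
      · rw [hsk i j, (hX'sk.congr b) i j, caseB j i hj hi]
    · rcases Nat.lt_or_ge (2 * k + 1) j.1 with hj | hj
      · exact caseB i j hi hj
      · rw [hent, hu0 i hi, hw0 i hi, hu0 j hj, hw0 j hj, hX'om i j (by omega)]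
        simp only [zero_mul, add_zero]
        by_cases h : i.1 < 2 * k ∨ j.1 < 2 * k
        · rw [hX i j h]
          by_cases h0 : i / 2 = j.1 / 2
          · rw [hd1 i (fun h => by rw [h] at h0; omega), hd1 j (fun h => by rw [h] at h0; omega)]
            ring
          · rw [om_zero h0]; simp
        · push Not at h
          have hi' : i = p0 ∨ i = p1 := by
            rw [Fin.ext_iff, Fin.ext_iff]; omega
          have hj' : j = p0 ∨ j = p1 := by
            rw [Fin.ext_iff, Fin.ext_iff]; omega
          rcases hi' with rfl | rfl <;> rcases hj' with rfl | rfl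
          · rw [hsk.diag]; simp [om]
          · rw [hd0, hd1 _ hne]; simp [om, hp0, hp1, hadef]
          · rw [hd0, hd1 _ hne, hsk i j, om_skew]; simp [om, hp0, hp1, hadef]
          · rw [hsk.diag]; simp [om]

theorem sb_line {n : ℕ} (f : PS n) (X E b : Mat n) (a : ℂ)
    (h : ∀ s : ℂ, a + s ≠ 0 → sb (b * (X + s • E) * b.transpose) f = 0) :
    sb (b * X * b.transpose) f = 0 := by
  let M : Matrix (Fin n) (Fin n) (Polynomial ℂ) :=
    cm (Polynomial ℂ) b * (cm (Polynomial ℂ) X + (Polynomial.X : Polynomial ℂ) • cm (Polynomial ℂ) E) * (cm (Polynomial ℂ) b).transpose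
  have hM : ∀ s : ℂ, M.map (Polynomial.aeval s) = b * (X + s • E) * b.transpose := by
    intro s
    have e : ∀ A : Mat n, (cm (Polynomial ℂ) A).map (Polynomial.aeval s) = A := by
      intro A; ext i j; simp
    have e2 : (cm (Polynomial ℂ) X + (Polynomial.X : Polynomial ℂ) • cm (Polynomial ℂ) E).map (Polynomial.aeval s)
        = X + s • E := by
      ext i j; simp; ring
    have e3 : (cm (Polynomial ℂ) b).transpose = cm _ b.transpose := rfl
    simp only [M]
    rw [Matrix.map_mul, Matrix.map_mul, e2, e3, e, e]
  have hQ : ∀ s : ℂ, Polynomial.eval s (sb M f) = sb (b * (X + s • E) * b.transpose) f := by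
    intro s
    rw [← hM, ← sb_map]
    rw [Polynomial.aeval_def, Polynomial.eval₂_eq_eval_map]; simp
  have h0 : sb M f * (Polynomial.X + Polynomial.C a) = 0 := by
    apply Polynomial.funext
    intro s
    rw [Polynomial.eval_mul, hQ]
    by_cases hs : a + s = 0
    · simp [add_comm s a, hs]
    · rw [h s hs]; simp
  have h1 : sb M f = 0 := by
    rcases mul_eq_zero.1 h0 with h | h
    · exact h
    · exact absurd h (Polynomial.X_add_C_ne_zero a)
  have := hQ 0
  rw [h1] at this
  simpa using this.symm

theorem skew_dense_aux (m : ℕ) (f : PS (2 * m))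
    (h : ∀ b : Mat (2 * m), IsLower b → sb (b * omM m ℂ * b.transpose) f = 0) (r : ℕ) :
    ∀ k, k + r = m → ∀ X, ZS m k X → ∀ b : Mat (2 * m), IsLower b → sb (b * X * b.transpose) f = 0 := by
  induction r with
  | zero =>
    intro k hk X hX b hb
    have : X = omM m ℂ := by
      ext i j
      rw [hX.2 i j (by have := i.isLt; omega)]; rfl
    rw [this]
    exact h b hb
  | succ r ih =>
    intro k hk X hX b hb
    have hk' : k < m := by omega
    apply sb_line f X (Matrix.of fun i j : Fin (2 * m) => if i.1 / 2 = k then ((om i.1 j.1 : ℤ) : ℂ) else 0) b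
      (X ⟨2 * k, by omega⟩ ⟨2 * k + 1, by omega⟩)
    intro s hs
    obtain ⟨c, X', hc, hX', he⟩ := ZS_step m k hk' (X + s • Matrix.of fun i j : Fin (2 * m) =>
        if i.1 / 2 = k then ((om i.1 j.1 : ℤ) : ℂ) else 0) (by
      refine ⟨?_, ?_⟩
      · intro i j
        rw [Matrix.add_apply, Matrix.add_apply, hX.1 i j]
        simp only [Matrix.smul_apply, Matrix.of_apply, smul_eq_mul]
        by_cases hij : i.1 / 2 = j.1 / 2
        · rw [hij, om_skew]
          split_ifs
          · push_cast; ring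
          · ring
        · rw [om_zero hij, om_zero (Ne.symm hij)]; simp
      · intro i j hij
        rw [Matrix.add_apply, hX.2 i j hij]
        simp only [Matrix.smul_apply, Matrix.of_apply, smul_eq_mul]
        split_ifs with h1
        · rw [om_zero (a := i.1) (b := j.1) (by omega)]; simp
        · simp) (by
      simp only [Matrix.add_apply, Matrix.smul_apply, Matrix.of_apply, smul_eq_mul]
      rw [if_pos (by omega)]
      simpa [om] using hs)
    rw [he]
    have := ih (k + 1) (by omega) X' hX' (b * c) (hb.mul hc)
    rw [← this]
    simp [Matrix.mul_assoc, Matrix.transpose_mul]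

theorem sb_all_zero {n : ℕ} (f : PS n) (h : ∀ X : Mat n, IsSkew X → sb X f = 0) : f = 0 := by
  apply MvPolynomial.funext
  intro x
  let X : Mat n := (genM n).map (MvPolynomial.eval x)
  have hX : IsSkew X := by
    intro i j
    simp only [X, Matrix.map_apply]
    rw [genM_skew i j, map_neg]
  have h1 := h X hX
  have h2 := sb_map (MvPolynomial.aeval x : PS n →ₐ[ℂ] ℂ) (genM n) f
  rw [sb_genM] at h2
  rw [map_zero]
  refine Eq.trans ?_ h1
  refine Eq.trans ?_ (h2.trans ?_)
  · rfl
  · rfl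

theorem skew_dense (m : ℕ) (f : PS (2 * m))
    (h : ∀ b : Mat (2 * m), IsLower b → sb (b * omM m ℂ * b.transpose) f = 0) : f = 0 := by
  apply sb_all_zero
  intro X hX
  have := skew_dense_aux m f h m 0 (by omega) X ⟨hX, by intro i j h; omega⟩ 1 isLower_one
  simpa using this

def genP (n : ℕ) : Matrix (Fin n) (Fin n) (MP n) := Matrix.of fun i j => MvPolynomial.X (i, j)

theorem genP_lact {n : ℕ} (g : Mat n) : (genP n).map (lact g) = cm (MP n) g * genP n := by
  ext1 i j
  rw [Matrix.map_apply, Matrix.mul_apply]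
  simp only [genP, Matrix.of_apply, lact_X, Matrix.map_apply]
  rfl

def evm {n : ℕ} (M : Mat n) : MP n →ₐ[ℂ] ℂ := MvPolynomial.aeval fun p => M p.1 p.2

theorem evm_lact {n : ℕ} (M g : Mat n) (p : MP n) : evm M (lact g p) = evm (g * M) p := by
  have : (evm M).comp (lact g) = evm (g * M) := by
    apply MvPolynomial.algHom_ext
    intro q
    simp only [AlgHom.comp_apply, lact_X, evm, map_sum, map_mul, MvPolynomial.aeval_X, Matrix.mul_apply]
    simp
  exact DFunLike.congr_fun this p

theorem genP_evm {n : ℕ} (M : Mat n) : (genP n).map (evm M) = M := by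
  ext i j
  simp [genP, evm]

theorem map_conj {R R' : Type*} [CommRing R] [CommRing R'] {n : ℕ} (ψ : R →+* R')
    (A Y : Matrix (Fin n) (Fin n) R) :
    (A * Y * A.transpose).map ψ = A.map ψ * Y.map ψ * (A.map ψ).transpose := by
  rw [Matrix.map_mul, Matrix.map_mul, Matrix.transpose_map]

def theta (m : ℕ) : PS (2 * m) →ₐ[ℂ] MP (2 * m) :=
  sb (genP (2 * m) * omM m (MP (2 * m)) * (genP (2 * m)).transpose)

theorem omM_map {R R' : Type*} [CommRing R] [CommRing R'] (m : ℕ) (ψ : R →+* R') :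
    (omM m R).map ψ = omM m R' := by
  ext i j; simp [omM]

theorem theta_lact {m : ℕ} (g : Mat (2 * m)) (f : PS (2 * m)) :
    lact g (theta m f) = theta m (glMap (2 * m) g f) := by
  rw [theta, sb_map, sb_glMap (omM_skew.congr _)]
  congr 2
  have h := map_conj (lact g : MP (2 * m) →+* MP (2 * m)) (genP (2 * m)) (omM m (MP (2 * m)))
  rw [omM_map] at h
  refine Eq.trans h ?_
  have h2 : (genP (2 * m)).map (lact g : MP (2 * m) →+* MP (2 * m)) = cm (MP (2 * m)) g * genP (2 * m) := genP_lact g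
  rw [h2]
  simp [Matrix.mul_assoc, Matrix.transpose_mul]

theorem evm_theta {m : ℕ} (M : Mat (2 * m)) (f : PS (2 * m)) :
    evm M (theta m f) = sb (M * omM m ℂ * M.transpose) f := by
  rw [theta, sb_map]
  congr 2
  have h := map_conj (evm M : MP (2 * m) →+* ℂ) (genP (2 * m)) (omM m (MP (2 * m)))
  rw [omM_map] at h
  refine Eq.trans h ?_
  have h2 : (genP (2 * m)).map (evm M : MP (2 * m) →+* ℂ) = M := genP_evm M
  rw [h2]

theorem theta_inj {m : ℕ} (f : PS (2 * m)) (h : theta m f = 0) : f = 0 := by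
  apply skew_dense
  intro b _
  rw [← evm_theta, h, map_zero]

theorem glMap_hw {m : ℕ} (b : Mat (2 * m)) (hb : ∀ i j, i < j → b i j = 0) (z : ℕ → ℕ) (hz : IsPartition m z) :
    glMap (2 * m) b (hwVector (2 * m) z) = (∏ i, b i i ^ z (i.1 / 2)) • hwVector (2 * m) z := by
  rw [glMap_eq, sb_hw_lower genM_skew _ _ z hz, sb_genM, Algebra.smul_def]
  · simp
  · intro i j hij
    show algebraMap ℂ (PS (2 * m)) (b i j) = 0
    rw [hb i j hij, map_zero]

theorem sb_HW {m : ℕ} (f : PS (2 * m)) (a : Fin (2 * m) → ℕ) (h : IsHW (theta m f) a) (b : Mat (2 * m))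
    (hb : IsLower b) : sb (b * omM m ℂ * b.transpose) f = (∏ i, b i i ^ a i) * sb (omM m ℂ) f := by
  have h1 := evm_lact 1 b (theta m f)
  rw [h.2.2 b hb, map_smul, evm_theta, mul_one, evm_theta] at h1
  rw [← h1]; simp

theorem hw_of_isHW {m : ℕ} (f : PS (2 * m)) (a : Fin (2 * m) → ℕ) (h : IsHW (theta m f) a) :
    ∃ y, IsPartition m y ∧ (∀ i : Fin (2 * m), a i = y (i.1 / 2)) ∧ ∃ c : ℂ, c ≠ 0 ∧
      f = c • hwVector (2 * m) y := by
  have hf0 : sb (omM m ℂ) f ≠ 0 := by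
    intro h0
    apply h.1
    have : f = 0 := by
      apply skew_dense
      intro b hb
      rw [sb_HW f a h b hb, h0, mul_zero]
    rw [this, map_zero]
  have hpair : ∀ k : Fin m, a (ev0 k) = a (ev1 k) := by
    intro k
    let τ : Fin (2 * m) → ℂ := fun i => if i = ev0 k then 2 else if i = ev1 k then 2⁻¹ else 1
    have hne : ev1 k ≠ ev0 k := by simp [ev0, ev1]
    have hτ : ∀ i, τ i ≠ 0 := by intro i; simp only [τ]; split_ifs <;> norm_num
    have h1 := sb_HW f a h (Matrix.diagonal τ) (isLower_diagonal τ hτ)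
    have h2 : Matrix.diagonal τ * omM m ℂ * (Matrix.diagonal τ).transpose = omM m ℂ := by
      ext i j
      rw [Matrix.diagonal_transpose, Matrix.mul_diagonal, Matrix.diagonal_mul]
      by_cases hz : om i.1 j.1 = 0
      · simp [omM, hz]
      · have hij := om_ne hz
        have hne' : i ≠ j := by rintro rfl; simp [om] at hz
        have hne2 : i.1 ≠ j.1 := fun h => hne' (Fin.ext h)
        have : τ i * τ j = 1 := by
          simp only [τ, Fin.ext_iff, ev0, ev1]
          split_ifs <;> first | omega | norm_num
        rw [mul_right_comm, this, one_mul]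
    rw [h2] at h1
    have h3 : ∏ i, (Matrix.diagonal τ) i i ^ a i = 1 := by
      have := h1.symm
      rwa [mul_eq_right₀ hf0] at this
    rw [← Finset.prod_subset (Finset.subset_univ {ev0 k, ev1 k}), Finset.prod_pair hne.symm] at h3
    · simp only [Matrix.diagonal_apply_eq, τ, if_true, if_neg hne] at h3
      rw [inv_pow, ← div_eq_mul_inv, div_eq_one_iff_eq (pow_ne_zero _ two_ne_zero)] at h3
      have h4 : (2 : ℕ) ^ a (ev0 k) = 2 ^ a (ev1 k) := by exact_mod_cast h3
      exact Nat.pow_right_injective (le_refl 2) h4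
    · intro i _ hi
      simp only [Finset.mem_insert, Finset.mem_singleton, not_or] at hi
      simp [τ, hi.1, hi.2]
  let y : ℕ → ℕ := fun k => if hk : k < m then a (ev0 ⟨k, hk⟩) else 0
  have hy : IsPartition m y := by
    refine ⟨?_, ?_⟩
    · intro i j hij
      simp only [y]
      by_cases hj : j < m
      · rw [dif_pos hj, dif_pos (by omega)]
        apply h.2.1
        rw [Fin.le_def]; simp [ev0]; omega
      · rw [dif_neg hj]; exact Nat.zero_le _
    · intro i hi
      simp only [y]; rw [dif_neg (by omega)]
  have hay : ∀ i : Fin (2 * m), a i = y (i.1 / 2) := by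
    intro i
    have hi := i.isLt
    simp only [y]
    rw [dif_pos (by omega)]
    rcases Nat.mod_two_eq_zero_or_one i.1 with h0 | h0
    · congr 1; ext; simp [ev0]; omega
    · rw [hpair]; congr 1; ext; simp [ev1]; omega
  refine ⟨y, hy, hay, sb (omM m ℂ) f * (sb (omM m ℂ) (hwVector (2 * m) y))⁻¹,
    mul_ne_zero hf0 (inv_ne_zero (sb_omM_hw y)), ?_⟩
  rw [← sub_eq_zero]
  apply skew_dense
  intro b hb
  rw [map_sub, map_smul, sb_HW f a h b hb, sb_hw_lower omM_skew b hb.1 y hy]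
  simp only [hay, smul_eq_mul]
  have := sb_omM_hw (m := m) y
  field_simp
  ring

def GStable {m : ℕ} (N : Submodule ℂ (PS (2 * m))) : Prop :=
  ∀ g : Mat (2 * m), IsUnit g.det → ∀ f ∈ N, glMap (2 * m) g f ∈ N

theorem GStable.map {m : ℕ} {N : Submodule ℂ (PS (2 * m))} (h : GStable N) :
    Stable (N.map (theta m).toLinearMap) := by
  rintro g hg _ ⟨f, hf, rfl⟩
  exact ⟨glMap (2 * m) g f, h g hg f hf, (theta_lact g f).symm⟩

theorem structure_lemma {m : ℕ} (N N' : Submodule ℂ (PS (2 * m))) (hN : GStable N) (hN' : GStable N')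
    (H : ∀ y, IsPartition m y → hwVector (2 * m) y ∈ N → hwVector (2 * m) y ∈ N') : N ≤ N' := by
  have hinj : Function.Injective (theta m).toLinearMap := by
    rw [injective_iff_map_eq_zero]
    exact fun f hf => theta_inj f hf
  have := key_lemma _ _ hN.map hN'.map (by
    rintro _ ⟨f, hf, rfl⟩ a ha
    obtain ⟨y, hy, _, c, hc, rfl⟩ := hw_of_isHW f a ha
    have h1 : hwVector (2 * m) y ∈ N := by
      have := N.smul_mem c⁻¹ hf
      rwa [smul_smul, inv_mul_cancel₀ hc, one_smul] at this
    exact ⟨_, N'.smul_mem c (H y hy h1), rfl⟩)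
  intro f hf
  obtain ⟨f', hf', he⟩ := this ⟨f, hf, rfl⟩
  exact hinj he ▸ hf'

def ZD (n k : ℕ) (X : Mat n) : Prop :=
  ∀ i j : Fin n, (i.1 < k ∨ j.1 < k) → X i j = if i = j then 1 else 0

theorem ZD_step (n : ℕ) (p : Fin n) (X : Mat n) (hX : ZD n p.1 X) (ha : X p p ≠ 0) :
    ∃ b X' c, IsLower b ∧ IsLower c ∧ ZD n (p.1 + 1) X' ∧ X = b * X' * c.conjTranspose := by
  set a := X p p with hadef
  set d : Fin n → ℂ := fun i => if i = p then a else 1 with hd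
  set u : Fin n → ℂ := fun i => if i.1 ≤ p.1 then 0 else X i p with hu
  set w : Fin n → ℂ := fun j => if j.1 ≤ p.1 then 0 else a⁻¹ * X p j with hw
  set X' : Mat n := Matrix.of fun i j => if i.1 < p.1 + 1 ∨ j.1 < p.1 + 1 then
    (if i = j then 1 else 0) else X i j - u i * w j with hX'
  set b : Mat n := Matrix.of fun i q => (if q = i then d i else 0) + (if q = p then u i else 0) with hb
  set c : Mat n := Matrix.of fun j q => (if q = j then 1 else 0) + (if q = p then star (w j) else 0) with hc
  have hu0 : ∀ i : Fin n, i.1 ≤ p.1 → u i = 0 := fun i h => by simp only [hu]; rw [if_pos h]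
  have hw0 : ∀ i : Fin n, i.1 ≤ p.1 → w i = 0 := fun i h => by simp only [hw]; rw [if_pos h]
  have hXd : ZD n (p.1 + 1) X' := fun i j h => by simp only [hX', Matrix.of_apply]; rw [if_pos h]
  have hent : ∀ i j, (b * X' * c.conjTranspose) i j =
      (d i * X' i j + u i * X' p j) + (d i * X' i p + u i * X' p p) * w j := by
    intro i j
    have h1 : ∀ q, (b * X') i q = d i * X' i q + u i * X' p q := by
      intro q
      rw [Matrix.mul_apply]
      simp [hb, add_mul, Finset.sum_add_distrib]
    rw [Matrix.mul_apply]
    have h2 : ∀ q, c.conjTranspose q j = (if q = j then 1 else 0) + (if q = p then w j else 0) := by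
      intro q
      rw [Matrix.conjTranspose_apply]
      simp only [hc, Matrix.of_apply, star_add]
      congr 1
      · split_ifs <;> simp
      · split_ifs <;> simp
    simp only [h1, h2, mul_add, Finset.sum_add_distrib]
    simp
  refine ⟨b, X', c, ⟨?_, ?_⟩, ⟨?_, ?_⟩, hXd, ?_⟩
  · intro i j hij
    have h1 := Fin.lt_def.1 hij
    simp only [hb, Matrix.of_apply]
    rw [if_neg hij.ne']
    split_ifs with h2
    · rw [hu0 i (by rw [h2] at h1; omega)]; simp
    · simp
  · intro i
    simp only [hb, Matrix.of_apply, if_true]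
    by_cases h0 : i = p
    · rw [if_pos h0, hu0 i (by rw [h0]), hd]
      simp [h0, ha]
    · rw [if_neg h0, hd]; simp [h0]
  · intro i j hij
    have h1 := Fin.lt_def.1 hij
    simp only [hc, Matrix.of_apply]
    rw [if_neg hij.ne']
    split_ifs with h2
    · rw [hw0 i (by rw [h2] at h1; omega)]; simp
    · simp
  · intro i
    simp only [hc, Matrix.of_apply, if_true]
    split_ifs with h0
    · rw [hw0 i (by rw [h0])]; simp
    · simp
  · ext i j
    rw [hent]
    have hpp : X' p p = 1 := by rw [hXd p p (by omega)]; simp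
    rw [hpp]
    rcases Nat.lt_trichotomy i.1 p.1 with hi | hi | hi
    · have hip : i ≠ p := fun h => by rw [h] at hi; omega
      rw [hu0 i hi.le, hXd i j (by omega), hXd i p (by omega), if_neg hip, hX i j (by omega)]
      simp [hd, hip]
    · have hip : i = p := Fin.ext hi
      subst hip
      rw [hu0 i le_rfl, hpp]
      have : d i = a := by simp [hd]
      rw [this, hXd i j (by omega)]
      rcases Nat.lt_trichotomy j.1 i.1 with hj | hj | hj
      · rw [hw0 j hj.le, hX i j (by omega)]
        have : i ≠ j := fun h => by rw [h] at hj; omega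
        simp [this]
      · have : j = i := Fin.ext hj
        subst this
        rw [hw0 j le_rfl]; simp [hadef]
      · have h1 : i ≠ j := fun h => by rw [h] at hj; omega
        have h2 : w j = a⁻¹ * X i j := by simp only [hw]; rw [if_neg (by omega)]
        rw [h2, if_neg h1]
        field_simp
        ring
    · have hip : i ≠ p := fun h => by rw [h] at hi; omega
      have h2 : u i = X i p := by simp only [hu]; rw [if_neg (by omega)]
      have : d i = 1 := by simp [hd, hip]
      rw [this, hXd p j (by omega), hXd i p (by omega), if_neg hip]
      rcases Nat.lt_trichotomy j.1 p.1 with hj | hj | hj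
      · have h1 : p ≠ j := fun h => by rw [h] at hj; omega
        have h3 : i ≠ j := fun h => by rw [h] at hi; omega
        rw [hw0 j hj.le, hX i j (by omega), hXd i j (by omega), if_neg h1, if_neg h3]; simp
      · have : j = p := Fin.ext hj
        subst this
        rw [hw0 j le_rfl, hXd i j (by omega), if_neg hip, h2]; simp
      · have h1 : p ≠ j := fun h => by rw [h] at hj; omega
        have : X' i j = X i j - u i * w j := by
          simp only [hX', Matrix.of_apply]; rw [if_neg (by omega)]
        rw [this, if_neg h1]; ring

theorem evm_line {n : ℕ} (P : MP n) (X E b c : Mat n) (a : ℂ)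
    (h : ∀ s : ℂ, a + s ≠ 0 → evm (b * (X + s • E) * c) P = 0) :
    evm (b * X * c) P = 0 := by
  let Q : Polynomial ℂ := MvPolynomial.aeval (fun p : Fin n × Fin n =>
    Polynomial.C ((b * X * c) p.1 p.2) + Polynomial.X * Polynomial.C ((b * E * c) p.1 p.2)) P
  have hQ : ∀ s : ℂ, Polynomial.eval s Q = evm (b * (X + s • E) * c) P := by
    intro s
    have : (Polynomial.aeval s).comp (MvPolynomial.aeval (fun p : Fin n × Fin n =>
      Polynomial.C ((b * X * c) p.1 p.2) + Polynomial.X * Polynomial.C ((b * E * c) p.1 p.2)))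
      = evm (b * (X + s • E) * c) := by
      apply MvPolynomial.algHom_ext
      intro p
      simp [evm, mul_add, add_mul]
      ring
    rw [← this]
    simp [Q, Polynomial.aeval_def, Polynomial.eval₂_eq_eval_map]
  have h0 : Q * (Polynomial.X + Polynomial.C a) = 0 := by
    apply Polynomial.funext
    intro s
    rw [Polynomial.eval_mul, hQ]
    by_cases hs : a + s = 0
    · simp [add_comm s a, hs]
    · rw [h s hs]; simp
  have h1 : Q = 0 := by
    rcases mul_eq_zero.1 h0 with h | h
    · exact h
    · exact absurd h (Polynomial.X_add_C_ne_zero a)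
  have := hQ 0
  rw [h1] at this
  simpa using this.symm

theorem mat_dense_aux (n : ℕ) (P : MP n)
    (h : ∀ b c : Mat n, IsLower b → IsLower c → evm (b * c.conjTranspose) P = 0) (r : ℕ) :
    ∀ k, k + r = n → ∀ X, ZD n k X → ∀ b c : Mat n, IsLower b → IsLower c →
      evm (b * X * c.conjTranspose) P = 0 := by
  induction r with
  | zero =>
    intro k hk X hX b c hb hc
    have : X = 1 := by
      ext i j
      rw [hX i j (by have := i.isLt; omega), Matrix.one_apply]
    rw [this, mul_one]
    exact h b c hb hc
  | succ r ih =>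
    intro k hk X hX b c hb hc
    obtain ⟨p, rfl⟩ : ∃ p : Fin n, p.1 = k := ⟨⟨k, by omega⟩, rfl⟩
    apply evm_line P X (Matrix.of fun i j => if i = p ∧ j = p then 1 else 0) b _ (X p p)
    intro s hs
    obtain ⟨b', X', c', hb', hc', hX', he⟩ := ZD_step n p
      (X + s • Matrix.of fun i j => if i = p ∧ j = p then 1 else 0) (by
        intro i j hij
        rw [Matrix.add_apply, hX i j hij]
        have : ¬ (i = p ∧ j = p) := by rintro ⟨rfl, rfl⟩; omega
        simp [this]) (by simpa using hs)
    rw [he]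
    have := ih (p.1 + 1) (by omega) X' hX' (b * b') (c * c') (hb.mul hb') (hc.mul hc')
    rw [← this]
    simp [Matrix.mul_assoc, Matrix.conjTranspose_mul]

theorem mat_dense {n : ℕ} (P : MP n)
    (h : ∀ b c : Mat n, IsLower b → IsLower c → evm (b * c.conjTranspose) P = 0) (X : Mat n) :
    evm X P = 0 := by
  have := mat_dense_aux n P h n 0 (by omega) X (by intro i j h; omega) 1 1 isLower_one isLower_one
  simpa using this

theorem poly_lact {n : ℕ} (h : MP n) : ∀ L : MP n →ₗ[ℂ] ℂ, ∃ P : MP n, ∀ g, L (lact g h) = evm g P := by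
  induction h using MvPolynomial.induction_on with
  | C a => 
    intro L
    refine ⟨MvPolynomial.C (L (MvPolynomial.C a)), fun g => ?_⟩
    rw [lact_C]; simp [evm]
  | add p q hp hq =>
    intro L
    obtain ⟨P, hP⟩ := hp L
    obtain ⟨Q, hQ⟩ := hq L
    exact ⟨P + Q, fun g => by rw [map_add, map_add, hP, hQ, map_add]⟩
  | mul_X p i hp =>
    intro L
    choose P hP using fun a => hp (L.comp (LinearMap.mulRight ℂ (MvPolynomial.X (a, i.2))))
    refine ⟨∑ a, MvPolynomial.X (i.1, a) * P a, fun g => ?_⟩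
    rw [map_mul, lact_X, Finset.mul_sum, map_sum, map_sum]
    apply Finset.sum_congr rfl
    intro a _
    rw [map_mul (evm g), ← hP]
    simp only [evm, MvPolynomial.aeval_X, LinearMap.comp_apply, LinearMap.mulRight_apply]
    rw [mul_left_comm, ← MvPolynomial.smul_eq_C_mul, map_smul, smul_eq_mul]

theorem fis_hw_one {n : ℕ} (v h : MP n) (a a' : Fin n → ℕ) (hv : IsHW v a) (hh : IsHW h a')
    (i : Fin n) (hi : ¬ a' i ≤ a i) (q : MP n) : fis v (h * q) = 0 := by
  induction q using MvPolynomial.induction_on' with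
  | add p q hp hq => rw [mul_add, fis_add_right, hp, hq, add_zero]
  | monomial α c =>
    by_contra hne
    apply hi
    let τ : Fin n → ℂ := fun j => if j = i then 2 else 1
    have hτ : ∀ j, τ j ≠ 0 := by intro j; simp only [τ]; split_ifs <;> norm_num
    have hL := isLower_diagonal τ hτ
    have hpr : ∀ e : Fin n → ℕ, ∏ j, τ j ^ e j = 2 ^ e i := by
      intro e
      rw [Finset.prod_eq_single i]
      · simp [τ]
      · intro j _ hj; simp [τ, hj]
      · simp
    have hct : (Matrix.diagonal τ).conjTranspose = Matrix.diagonal τ := by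
      rw [Matrix.diagonal_conjTranspose]
      congr 1; funext j; show star (if j = i then (2 : ℂ) else 1) = if j = i then 2 else 1
      split_ifs <;> simp
    have h1 := fis_lact (Matrix.diagonal τ) v (h * MvPolynomial.monomial α c)
    rw [hct, map_mul, hv.2.2 _ hL, hh.2.2 _ hL, lact_diag_monomial] at h1
    simp only [Matrix.diagonal_apply_eq, hpr] at h1
    rw [smul_mul_smul_comm, fis_smul_left, fis_smul_right, ← pow_add, map_pow] at h1
    have h2 := mul_right_cancel₀ hne h1
    have h3 : (2 : ℕ) ^ a i = 2 ^ (a' i + wtt α i) := by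
      have : (starRingEnd ℂ) 2 = 2 := map_ofNat _ 2
      rw [this] at h2
      exact_mod_cast h2
    have := Nat.pow_right_injective (le_refl 2) h3
    omega

theorem fis_hw {n : ℕ} (v h : MP n) (a a' : Fin n → ℕ) (hv : IsHW v a) (hh : IsHW h a')
    (i : Fin n) (hi : ¬ a' i ≤ a i) (g : Mat n) (q : MP n) : fis v (lact g h * q) = 0 := by
  obtain ⟨P, hP⟩ := poly_lact h ((fisL v).comp (LinearMap.mulRight ℂ q))
  have hP' : ∀ g, fis v (lact g h * q) = evm g P := hP
  rw [hP']
  apply mat_dense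
  intro b c hb hc
  rw [← hP', ← lact_lact, hh.2.2 b hb, map_smul, smul_mul_assoc, fis_smul_right]
  have hu : IsUnit c.conjTranspose.det := by
    rw [Matrix.det_conjTranspose]; exact hc.det.star
  have : lact c.conjTranspose h * q = lact c.conjTranspose (h * lact (c.conjTranspose)⁻¹ q) := by
    rw [map_mul, lact_lact, Matrix.nonsing_inv_mul _ hu, lact_one]
  rw [this, ← fis_lact, hv.2.2 c hc, fis_smul_left, fis_hw_one v h a a' hv hh i hi]
  simp

theorem theta_hw {m : ℕ} (z : ℕ → ℕ) (hz : IsPartition m z) :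
    IsHW (theta m (hwVector (2 * m) z)) (fun i => z (i.1 / 2)) := by
  refine ⟨?_, ?_, ?_⟩
  · intro h
    apply sb_omM_hw (m := m) z
    rw [theta_inj _ h, map_zero]
  · intro i j hij
    apply hz.1
    have := Fin.le_def.1 hij
    omega
  · intro b hb
    rw [theta_lact, glMap_hw b hb.1 z hz, map_smul]

theorem mem_invIdeal {m : ℕ} (Z : Set (ℕ → ℕ)) (hZ : ∀ z ∈ Z, IsPartition m z) (y : ℕ → ℕ)
    (hy : IsPartition m y) (h : hwVector (2 * m) y ∈ ⨆ z ∈ Z, invIdeal (2 * m) z) :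
    ∃ z ∈ Z, ∀ i, z i ≤ y i := by
  by_contra hc
  push Not at hc
  have hv := theta_hw y hy
  let A : Ideal (PS (2 * m)) :=
    { carrier := {x | ∀ q, fis (theta m (hwVector (2 * m) y)) (theta m x * q) = 0}
      add_mem' := by
        intro a b ha hb q
        rw [map_add, add_mul, fis_add_right, ha q, hb q, add_zero]
      zero_mem' := by
        intro q
        rw [map_zero, zero_mul]
        exact (fisL _).map_zero
      smul_mem' := by
        intro c x hx q
        rw [smul_eq_mul, map_mul, mul_assoc, mul_left_comm]
        exact hx _ }
  have hle : (⨆ z ∈ Z, invIdeal (2 * m) z) ≤ A := by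
    refine iSup₂_le fun z hz => ?_
    rw [invIdeal, Ideal.span_le]
    rintro _ ⟨g, rfl⟩ q
    obtain ⟨i, hi⟩ := hc z hz
    have him : i < m := by
      by_contra hc'
      rw [(hZ z hz).2 i (by omega)] at hi
      omega
    rw [← theta_lact]
    apply fis_hw _ _ _ _ hv (theta_hw z (hZ z hz)) ⟨2 * i, by omega⟩
    simp only [not_le]
    rwa [Nat.mul_div_cancel_left _ (by norm_num)]
  have h1 := hle h 1
  rw [mul_one] at h1
  exact hv.1 (fis_self_eq_zero _ h1)

abbrev PP (m : ℕ) := Polynomial (MP (2 * m))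

def Tht (m l : ℕ) : PS (2 * m) →ₐ[ℂ] PP m :=
  sb ((genP (2 * m)).map Polynomial.C * omS m l (Polynomial.X : PP m) * ((genP (2 * m)).map Polynomial.C).transpose)

theorem omS_map {R R' : Type*} [CommRing R] [CommRing R'] [Algebra ℂ R] [Algebra ℂ R'] (m l : ℕ)
    (ψ : R →+* R') (s : R) :
    (omS m l s).map ψ = omS m l (ψ s) := by
  ext i j
  simp only [omS, Matrix.map_apply, Matrix.of_apply, map_mul, map_intCast]
  split_ifs <;> simp

theorem conj_mul {R : Type*} [CommRing R] {n : ℕ} (A B Y : Matrix (Fin n) (Fin n) R) :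
    A * B * Y * (A * B).transpose = A * (B * Y * B.transpose) * A.transpose := by
  simp [Matrix.mul_assoc, Matrix.transpose_mul]

theorem Tht_map {R : Type*} [CommRing R] [Algebra ℂ R] {m l : ℕ} (ψ : PP m →ₐ[ℂ] R) (f : PS (2 * m))
    (A : Matrix (Fin (2 * m)) (Fin (2 * m)) R) (hA : ∀ i j, ψ (Polynomial.C (genP (2 * m) i j)) = A i j) :
    ψ (Tht m l f) = sb (A * omS m l (ψ Polynomial.X) * A.transpose) f := by
  rw [Tht, sb_map]
  congr 2
  have h := map_conj (ψ : PP m →+* R) ((genP (2 * m)).map Polynomial.C) (omS m l (Polynomial.X : PP m))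
  rw [omS_map] at h
  refine Eq.trans h ?_
  have h2 : ((genP (2 * m)).map Polynomial.C).map (ψ : PP m →+* R) = A := by
    ext1 i j
    exact hA i j
  rw [h2]
  rfl

theorem Tht_lact {m l : ℕ} (g : Mat (2 * m)) (f : PS (2 * m)) :
    Polynomial.mapAlgHom (lact g) (Tht m l f) = Tht m l (glMap (2 * m) g f) := by
  rw [Tht_map (Polynomial.mapAlgHom (lact g)) f (cm (PP m) g * (genP (2 * m)).map Polynomial.C)]
  · have hX : Polynomial.mapAlgHom (lact g) (Polynomial.X : PP m) = Polynomial.X := by simp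
    rw [Tht, sb_glMap ((omS_skew _ _).congr _), conj_mul, hX]
  · intro i j
    have h1 : lact g (genP (2 * m) i j) = (cm (MP (2 * m)) g * genP (2 * m)) i j := by
      rw [← genP_lact]; rfl
    simp only [Polynomial.coe_mapAlgHom, Polynomial.map_C, RingHom.coe_coe]
    rw [h1, Matrix.mul_apply, Matrix.mul_apply, map_sum]
    apply Finset.sum_congr rfl
    intro a _
    rw [map_mul]; rfl

theorem Tht_evm {m l : ℕ} (f : PS (2 * m)) :
    Polynomial.mapAlgHom (evm 1) (Tht m l f) = sb (omS m l (Polynomial.X : Polynomial ℂ)) f := by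
  rw [Tht_map (Polynomial.mapAlgHom (evm 1)) f 1]
  · simp
  · intro i j
    simp only [Polynomial.coe_mapAlgHom, Polynomial.map_C, RingHom.coe_coe]
    have h1 : evm 1 (genP (2 * m) i j) = (1 : Mat (2 * m)) i j := by
      conv_rhs => rw [← genP_evm (1 : Mat (2 * m))]
      rfl
    rw [h1, Matrix.one_apply, Matrix.one_apply]
    split_ifs <;> simp

def Phi (m l e : ℕ) : PS (2 * m) →ₗ[ℂ] MP (2 * m) :=
  ((Polynomial.lcoeff (MP (2 * m)) e).restrictScalars ℂ).comp (Tht m l).toLinearMap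

theorem Phi_apply {m l e : ℕ} (f : PS (2 * m)) : Phi m l e f = (Tht m l f).coeff e := rfl

theorem Phi_lact {m l e : ℕ} (g : Mat (2 * m)) (f : PS (2 * m)) :
    lact g (Phi m l e f) = Phi m l e (glMap (2 * m) g f) := by
  rw [Phi_apply, Phi_apply, ← Tht_lact, Polynomial.coe_mapAlgHom, Polynomial.coeff_map]
  rfl

def th0 (m l : ℕ) : PS (2 * m) →ₐ[ℂ] MP (2 * m) :=
  sb (genP (2 * m) * omS m l (0 : MP (2 * m)) * (genP (2 * m)).transpose)

theorem th0_eq {m l : ℕ} (f : PS (2 * m)) : th0 m l f = (Tht m l f).coeff 0 := by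
  have := Tht_map (m := m) (l := l) ((Polynomial.aeval (0 : MP (2 * m))).restrictScalars ℂ) f (genP (2 * m)) (by
    intro i j; simp)
  rw [Polynomial.coeff_zero_eq_aeval_zero]
  simp only [AlgHom.coe_restrictScalars', Polynomial.aeval_X] at this
  exact this.symm

theorem th0_lact {m l : ℕ} (g : Mat (2 * m)) (f : PS (2 * m)) :
    lact g (th0 m l f) = th0 m l (glMap (2 * m) g f) := by
  rw [th0_eq, th0_eq]
  exact Phi_lact (e := 0) g f

theorem Tht_inv_dvd {m l : ℕ} (z : ℕ → ℕ) (hz : IsPartition m z) (f : PS (2 * m))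
    (hf : f ∈ invIdeal (2 * m) z) : (Polynomial.X : PP m) ^ tailsum m l z ∣ Tht m l f := by
  have h : invIdeal (2 * m) z ≤ Ideal.comap (Tht m l) (Ideal.span {(Polynomial.X : PP m) ^ tailsum m l z}) := by
    rw [invIdeal, Ideal.span_le]
    rintro _ ⟨g, rfl⟩
    rw [SetLike.mem_coe, Ideal.mem_comap, Ideal.mem_span_singleton, ← Tht_lact]
    have := map_dvd (Polynomial.mapAlgHom (lact g.val)) (sb_omS_hw_dvd l (Polynomial.X : PP m)
      ((genP (2 * m)).map Polynomial.C) z hz)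
    rw [map_pow] at this
    have hX : Polynomial.mapAlgHom (lact g.val) (Polynomial.X : PP m) = Polynomial.X := by simp
    rw [hX] at this
    exact this
  exact Ideal.mem_span_singleton.1 (h hf)

theorem succSet_iff {m l : ℕ} (ν y : ℕ → ℕ) : y ∈ succSet m ν l ↔
    IsPartition m y ∧ (∀ i, ν i ≤ y i) ∧ ∃ i, l ≤ i ∧ i < m ∧ ν i < y i := Iff.rfl

theorem succIdeal_eq {m l : ℕ} (ν : ℕ → ℕ) :
    succIdeal (2 * m) ν l = ⨆ y ∈ succSet m ν l, invIdeal (2 * m) y := by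
  rw [succIdeal, Nat.mul_div_cancel_left m (by norm_num)]

theorem Tht_succ_dvd {m l : ℕ} (ν : ℕ → ℕ) (f : PS (2 * m))
    (hf : f ∈ succIdeal (2 * m) ν l) : (Polynomial.X : PP m) ^ (tailsum m l ν + 1) ∣ Tht m l f := by
  have h : succIdeal (2 * m) ν l ≤
      Ideal.comap (Tht m l) (Ideal.span {(Polynomial.X : PP m) ^ (tailsum m l ν + 1)}) := by
    rw [succIdeal_eq]
    refine iSup₂_le fun y hy => ?_
    intro x hx
    rw [Ideal.mem_comap, Ideal.mem_span_singleton]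
    obtain ⟨hyp, hle, i, hli, him, hlt⟩ := hy
    refine dvd_trans (pow_dvd_pow _ ?_) (Tht_inv_dvd y hyp x hx)
    rw [Nat.succ_le_iff, tailsum, tailsum]
    apply Finset.sum_lt_sum
    · intro k _; split_ifs
      · exact hle k
      · exact le_rfl
    · exact ⟨i, Finset.mem_range.2 him, by rw [if_pos hli, if_pos hli]; exact hlt⟩
  exact Ideal.mem_span_singleton.1 (h hf)

theorem Phi_mul {m l : ℕ} (ν : ℕ → ℕ) (hν : IsPartition m ν) (x f : PS (2 * m))
    (hf : f ∈ invIdeal (2 * m) ν) :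
    Phi m l (tailsum m l ν) (x * f) = th0 m l x * Phi m l (tailsum m l ν) f := by
  obtain ⟨h, hh⟩ := Tht_inv_dvd (l := l) ν hν f hf
  rw [Phi_apply, Phi_apply, map_mul, hh, th0_eq, mul_left_comm, Polynomial.coeff_X_pow_mul',
    Polynomial.coeff_X_pow_mul']
  simp [Polynomial.mul_coeff_zero]

theorem Phi_succ {m l : ℕ} (ν : ℕ → ℕ) (f : PS (2 * m))
    (hf : f ∈ succIdeal (2 * m) ν l) : Phi m l (tailsum m l ν) f = 0 := by
  obtain ⟨h, hh⟩ := Tht_succ_dvd (l := l) ν f hf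
  rw [Phi_apply, hh, Polynomial.coeff_X_pow_mul']
  simp

theorem hw_mem {m : ℕ} (z : ℕ → ℕ) : hwVector (2 * m) z ∈ invIdeal (2 * m) z := by
  apply Ideal.subset_span
  refine ⟨1, ?_⟩
  simp [glMap_one]

theorem hw_mem_le {m : ℕ} (ν y : ℕ → ℕ) (hν : IsPartition m ν) (hy : IsPartition m y)
    (h : hwVector (2 * m) y ∈ invIdeal (2 * m) ν) : ∀ i, ν i ≤ y i := by
  obtain ⟨z, hz, h'⟩ := mem_invIdeal {ν} (by rintro _ rfl; exact hν) y hy (by simpa using h)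
  rw [Set.mem_singleton_iff] at hz
  subst hz; exact h'

theorem Phi_hw_ne {m l : ℕ} (y : ℕ → ℕ) (hy : IsPartition m y) :
    Phi m l (tailsum m l y) (hwVector (2 * m) y) ≠ 0 := by
  intro h
  have h1 := Tht_evm (l := l) (hwVector (2 * m) y)
  rw [sb_omS_hw l _ y hy] at h1
  have h2 := congrArg (fun p => Polynomial.coeff p (tailsum m l y)) h1
  simp only [Polynomial.coe_mapAlgHom, Polynomial.coeff_map] at h2
  rw [Phi_apply] at h
  rw [h, Polynomial.coeff_X_pow_mul'] at h2
  simp at h2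
  exact sb_omM_hw y h2.symm

theorem invIdeal_stable {m : ℕ} (z : ℕ → ℕ) : GStable ((invIdeal (2 * m) z).restrictScalars ℂ) := by
  intro g hg f hf
  have h : invIdeal (2 * m) z ≤ Ideal.comap (glMap (2 * m) g) (invIdeal (2 * m) z) := by
    conv_lhs => rw [invIdeal]
    rw [Ideal.span_le]
    rintro _ ⟨g', rfl⟩
    rw [SetLike.mem_coe, Ideal.mem_comap, glMap_glMap]
    apply Ideal.subset_span
    obtain ⟨u, hu⟩ := (Matrix.isUnit_iff_isUnit_det g).2 hg
    refine ⟨g' * u, ?_⟩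
    rw [← hu]; rfl
  exact h hf

theorem succIdeal_stable {m l : ℕ} (ν : ℕ → ℕ) : GStable ((succIdeal (2 * m) ν l).restrictScalars ℂ) := by
  intro g hg f hf
  have h : succIdeal (2 * m) ν l ≤ Ideal.comap (glMap (2 * m) g) (succIdeal (2 * m) ν l) := by
    conv_lhs => rw [succIdeal_eq]
    refine iSup₂_le fun y hy x hx => ?_
    rw [Ideal.mem_comap, succIdeal_eq]
    exact (le_iSup₂_of_le y hy le_rfl : invIdeal (2 * m) y ≤ _) (invIdeal_stable y g hg x hx)
  exact h hf

theorem hw_dichotomy {m l : ℕ} (ν y : ℕ → ℕ) (hν : IsPartition m ν) (hy : IsPartition m y)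
    (h : hwVector (2 * m) y ∈ invIdeal (2 * m) ν) :
    hwVector (2 * m) y ∈ succIdeal (2 * m) ν l ∨ (∀ i, l ≤ i → y i = ν i) := by
  have hle := hw_mem_le ν y hν hy h
  by_cases hs : y ∈ succSet m ν l
  · left
    rw [succIdeal_eq]
    exact (le_iSup₂_of_le y hs le_rfl : invIdeal (2 * m) y ≤ _) (hw_mem y)
  · right
    intro i hi
    by_contra hne
    apply hs
    refine ⟨hy, hle, i, hi, ?_, lt_of_le_of_ne (hle i) (Ne.symm hne)⟩
    by_contra him
    rw [hy.2 i (by omega), hν.2 i (by omega)] at hne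
    exact hne rfl

theorem Phi_inj {m l : ℕ} (ν : ℕ → ℕ) (hν : IsPartition m ν) (f : PS (2 * m))
    (hf : f ∈ invIdeal (2 * m) ν) (h0 : Phi m l (tailsum m l ν) f = 0) :
    f ∈ succIdeal (2 * m) ν l := by
  have := structure_lemma ((invIdeal (2 * m) ν).restrictScalars ℂ ⊓ LinearMap.ker (Phi m l (tailsum m l ν)))
    ((succIdeal (2 * m) ν l).restrictScalars ℂ) (by
      intro g hg f hf
      refine ⟨invIdeal_stable ν g hg f hf.1, ?_⟩
      rw [SetLike.mem_coe, LinearMap.mem_ker, ← Phi_lact, LinearMap.mem_ker.1 hf.2, map_zero])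
    (succIdeal_stable ν) (by
      rintro y hy ⟨hyI, hyK⟩
      rcases hw_dichotomy (l := l) ν y hν hy hyI with h | h
      · exact h
      · exfalso
        apply Phi_hw_ne (l := l) y hy
        have : tailsum m l y = tailsum m l ν := by
          apply Finset.sum_congr rfl
          intro k _
          split_ifs with hk
          · exact h k hk
          · rfl
        rw [this]; exact hyK)
  exact this ⟨hf, h0⟩

theorem mIdeal_glMap {n : ℕ} (g : Mat n) (t : ℕ) (x : PS n) (hx : x ∈ mIdeal n ^ t) :
    glMap n g x ∈ mIdeal n ^ t := by
  have h1 : mIdeal n ≤ Ideal.comap (glMap n g) (mIdeal n) := by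
    intro y hy
    rw [Ideal.mem_comap, mIdeal, RingHom.mem_ker, evalMat_eq]
    have hz : IsSkew (0 : Mat n) := fun i j => by simp
    rw [sb_glMap hz]
    rw [mIdeal, RingHom.mem_ker, evalMat_eq] at hy
    simpa using hy
  have h2 := Ideal.pow_right_mono h1 t
  exact (Ideal.le_comap_pow (glMap n g) t) (h2 hx)

theorem X_mem {n : ℕ} (p : SkewIdx n) : (MvPolynomial.X p : PS n) ∈ mIdeal n := by
  rw [mIdeal, RingHom.mem_ker, evalMat_eq]
  simp [sb]

theorem th0_zero {m : ℕ} (x : PS (2 * m)) (hx : x ∈ mIdeal (2 * m)) : th0 m 0 x = 0 := by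
  have h0 : omS m 0 (0 : MP (2 * m)) = 0 := by
    ext1 i j; simp [omS]
  have h1 := sb_map (Algebra.ofId ℂ (MP (2 * m))) (0 : Mat (2 * m)) x
  rw [mIdeal, RingHom.mem_ker, evalMat_eq] at hx
  rw [hx, map_zero] at h1
  rw [th0, h0, mul_zero, zero_mul, h1]
  congr 2
  ext1 i j
  simp

theorem hw_add {m : ℕ} (y z : ℕ → ℕ) (hy : IsPartition m y) (hz : IsPartition m z) :
    hwVector (2 * m) (fun i => y i + z i) = hwVector (2 * m) y * hwVector (2 * m) z := by
  rw [hwVector, hwVector, hwVector, ← Finset.prod_mul_distrib]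
  apply Finset.prod_congr rfl
  intro k _
  rw [← pow_add]
  congr 1
  have h1 := hy.1 k (k + 1) (by omega)
  have h2 := hz.1 k (k + 1) (by omega)
  omega

theorem rect_part {m l t : ℕ} (hl : l ≤ m) : IsPartition m (rect l t) := by
  refine ⟨?_, ?_⟩
  · intro i j hij
    simp only [rect]
    split_ifs <;> omega
  · intro i hi
    simp only [rect]
    rw [if_neg (by omega)]

theorem hw_rect_mem {m l : ℕ} (hl1 : 1 ≤ l) (hl : l < m) (t : ℕ) :
    hwVector (2 * m) (rect l t) ∈ mIdeal (2 * m) ^ t := by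
  have h1 : hwVector (2 * m) (rect l 1) ∈ mIdeal (2 * m) := by
    rw [mIdeal, RingHom.mem_ker, evalMat_eq]
    have hz : IsSkew (0 : Mat (2 * m)) := fun i j => by simp
    have := sb_hw_lower hz 0 (fun i j _ => rfl) (rect l 1) (rect_part hl.le)
    rw [Finset.prod_eq_zero (Finset.mem_univ (⟨0, by omega⟩ : Fin (2 * m)))] at this
    · simpa using this
    · simp [rect]; omega
  induction t with
  | zero => simp
  | succ t ih =>
    have : rect l (t + 1) = fun i => rect l t i + rect l 1 i := by
      ext i; simp only [rect]; split_ifs <;> omega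
    rw [this, hw_add _ _ (rect_part hl.le) (rect_part hl.le), pow_succ]
    exact Ideal.mul_mem_mul ih h1

theorem relprime_aux {σ : Type*} (p q : MvPolynomial σ ℂ) (hp : p ≠ 0) (hq : q ≠ 0)
    (h : ∀ i, p.degreeOf i = 0 ∨ q.degreeOf i = 0) : IsRelPrime p q := by
  intro d hdp hdq
  have hd0 : d ≠ 0 := fun h0 => by rw [h0, zero_dvd_iff] at hdp; exact hp hdp
  have hdeg : ∀ i, d.degreeOf i = 0 := by
    have aux : ∀ (p : MvPolynomial σ ℂ), p ≠ 0 → d ∣ p → ∀ i, d.degreeOf i ≤ p.degreeOf i := by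
      rintro _ hp ⟨e, rfl⟩ i
      rw [MvPolynomial.degreeOf_mul_eq hd0 (right_ne_zero_of_mul hp)]
      omega
    intro i
    have h1 := aux p hp hdp i
    have h2 := aux q hq hdq i
    rcases h i with h | h <;> omega
  have hc : d = MvPolynomial.C (d.coeff 0) := by
    rw [← MvPolynomial.totalDegree_eq_zero_iff_eq_C, MvPolynomial.totalDegree_eq_zero_iff]
    intro s hs i
    have := MvPolynomial.monomial_le_degreeOf i hs
    have := hdeg i
    omega
  rw [hc]
  apply IsUnit.map
  rw [isUnit_iff_ne_zero]
  intro h0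
  rw [h0, map_zero] at hc
  exact hd0 hc

theorem th0_X_deg {m l : ℕ} (p : SkewIdx (2 * m)) (i : Fin (2 * m) × Fin (2 * m)) (h1 : i.1 ≠ p.1.1)
    (h2 : i.1 ≠ p.1.2) : (th0 m l (MvPolynomial.X p)).degreeOf i = 0 := by
  have : th0 m l (MvPolynomial.X p) = (genP (2 * m) * omS m l (0 : MP (2 * m)) * (genP (2 * m)).transpose) p.1.1 p.1.2 := by
    simp [th0, sb]
  rw [this, conj_apply, ← Nat.le_zero]
  refine (MvPolynomial.degreeOf_sum_le _ _ _).trans (Finset.sup_le fun a _ => ?_)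
  refine (MvPolynomial.degreeOf_sum_le _ _ _).trans (Finset.sup_le fun b _ => ?_)
  refine (MvPolynomial.degreeOf_mul_le _ _ _).trans ?_
  have e1 : MvPolynomial.degreeOf i (genP (2 * m) p.1.1 a * genP (2 * m) p.1.2 b) ≤ 0 := by
    refine (MvPolynomial.degreeOf_mul_le _ _ _).trans ?_
    simp only [genP, Matrix.of_apply]
    rw [MvPolynomial.degreeOf_X_of_ne (fun h => h1 (by rw [h])), MvPolynomial.degreeOf_X_of_ne (fun h => h2 (by rw [h]))]
  have e2 : MvPolynomial.degreeOf i (omS m l (0 : MP (2 * m)) a b) ≤ 0 := by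
    have : omS m l (0 : MP (2 * m)) a b = MvPolynomial.C (((om a.1 b.1 : ℤ) : ℂ) * if 2 * l ≤ a.1 then 0 else 1) := by
      simp only [omS, Matrix.of_apply]
      split_ifs <;> simp
    rw [this, MvPolynomial.degreeOf_C]
  omega

theorem evm_th0 {m l : ℕ} (f : PS (2 * m)) (M : Mat (2 * m)) :
    evm M (th0 m l f) = sb (M * omS m l (0 : ℂ) * M.transpose) f := by
  rw [th0, sb_map]
  congr 2
  have h := map_conj (evm M : MP (2 * m) →+* ℂ) (genP (2 * m)) (omS m l (0 : MP (2 * m)))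
  rw [omS_map, map_zero] at h
  refine Eq.trans h ?_
  have h2 : (genP (2 * m)).map (evm M : MP (2 * m) →+* ℂ) = M := genP_evm M
  rw [h2]

theorem th0_X_ne {m l : ℕ} (hl : 1 ≤ l) (hm : 0 < m) (p : SkewIdx (2 * m)) : th0 m l (MvPolynomial.X p) ≠ 0 := by
  intro h
  have h1 := evm_th0 (l := l) (MvPolynomial.X p) (Matrix.of fun i j : Fin (2 * m) =>
    if (i = p.1.1 ∧ j.1 = 0) ∨ (i = p.1.2 ∧ j.1 = 1) then 1 else 0)
  rw [h, map_zero] at h1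
  have hp : p.1.1 ≠ p.1.2 := p.2.ne
  simp only [sb, MvPolynomial.aeval_X] at h1
  rw [conj_apply, Finset.sum_eq_single ⟨0, by omega⟩, Finset.sum_eq_single ⟨1, by omega⟩] at h1
  · simp [omS, om, hp] at h1
    omega
  · intro b _ hb
    have : b.1 ≠ 1 := fun h => hb (Fin.ext h)
    simp [hp.symm, this]
  · simp
  · intro a _ ha
    apply Finset.sum_eq_zero
    intro b _
    have : a.1 ≠ 0 := fun h => ha (Fin.ext h)
    simp [hp, this]
  · simp

theorem hw_quot {m l : ℕ} (ν : ℕ → ℕ) (hν : IsPartition m ν) (u : MP (2 * m)) (a : Fin (2 * m) → ℕ)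
    (hu : IsHW u a) (f : PS (2 * m)) (hf : f ∈ invIdeal (2 * m) ν) (hfu : Phi m l (tailsum m l ν) f = u) :
    ∃ y, IsPartition m y ∧ (∀ i, l ≤ i → y i = ν i) ∧ (∀ i : Fin (2 * m), a i = y (i.1 / 2)) ∧
      ∃ c : ℂ, u = c • Phi m l (tailsum m l ν) (hwVector (2 * m) y) := by
  have hst : GStable ((succIdeal (2 * m) ν l).restrictScalars ℂ ⊓ (invIdeal (2 * m) ν).restrictScalars ℂ) :=
    fun g hg f hf => ⟨succIdeal_stable ν g hg f hf.1, invIdeal_stable ν g hg f hf.2⟩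
  obtain ⟨R, hR, -, hRK, a0, ⟨k, hk, rfl⟩, ha0⟩ := compl_exists _ hst.map (theta m f)
  obtain ⟨r, hr⟩ : ∃ r, r = f - k := ⟨_, rfl⟩
  have hrR : theta m r ∈ R := by
    rw [hr, map_sub]; exact ha0
  have hrI : r ∈ invIdeal (2 * m) ν := by
    rw [hr]; exact Ideal.sub_mem _ hf hk.2
  have hru : Phi m l (tailsum m l ν) r = u := by
    rw [hr, map_sub, hfu, Phi_succ ν k hk.1, sub_zero]
  have hHW : IsHW (theta m r) a := by
    refine ⟨?_, hu.2.1, ?_⟩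
    · intro h
      apply hu.1
      rw [← hru, theta_inj r h, map_zero]
    · intro b hb
      have e : theta m (glMap (2 * m) b r - (∏ i, b i i ^ a i) • r) = 0 := by
        apply hRK
        · rw [map_sub, ← theta_lact, map_smul]
          exact R.sub_mem (hR b hb.det _ hrR) (R.smul_mem _ hrR)
        · have hI : glMap (2 * m) b r - (∏ i, b i i ^ a i) • r ∈ invIdeal (2 * m) ν :=
            Submodule.sub_mem ((invIdeal (2 * m) ν).restrictScalars ℂ) (invIdeal_stable ν b hb.det r hrI)
              (Submodule.smul_mem ((invIdeal (2 * m) ν).restrictScalars ℂ) _ hrI)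
          refine ⟨_, ⟨Phi_inj ν hν _ hI ?_, hI⟩, rfl⟩
          rw [map_sub, ← Phi_lact, map_smul, hru, hu.2.2 b hb, sub_self]
      rw [map_sub, map_smul, ← theta_lact, sub_eq_zero] at e
      exact e
  obtain ⟨y, hy, hay, c, hc, hrc⟩ := hw_of_isHW r a hHW
  have hyI : hwVector (2 * m) y ∈ invIdeal (2 * m) ν := by
    have := Submodule.smul_mem ((invIdeal (2 * m) ν).restrictScalars ℂ) c⁻¹ hrI
    rw [hrc, smul_smul, inv_mul_cancel₀ hc, one_smul] at this
    exact this
  refine ⟨y, hy, ?_, hay, c, ?_⟩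
  · rcases hw_dichotomy (l := l) ν y hν hy hyI with h | h
    · exfalso
      apply hu.1
      rw [← hru, hrc, map_smul, Phi_succ ν _ h, smul_zero]
    · exact h
  · rw [← hru, hrc, map_smul]

def DD (m l t : ℕ) (ν : ℕ → ℕ) : Submodule ℂ (MP (2 * m)) where
  carrier := {p | ∀ c ∈ mIdeal (2 * m) ^ t, th0 m l c * p ∈
    ((invIdeal (2 * m) ν).restrictScalars ℂ).map (Phi m l (tailsum m l ν))}
  add_mem' := by
    intro p q hp hq c hc
    rw [mul_add]
    exact Submodule.add_mem _ (hp c hc) (hq c hc)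
  zero_mem' := by
    intro c _
    rw [mul_zero]
    exact Submodule.zero_mem _
  smul_mem' := by
    intro a p hp c hc
    rw [mul_smul_comm]
    exact Submodule.smul_mem _ _ (hp c hc)

theorem Phi_stable {m l : ℕ} (ν : ℕ → ℕ) :
    Stable (((invIdeal (2 * m) ν).restrictScalars ℂ).map (Phi m l (tailsum m l ν))) := by
  rintro g hg _ ⟨f, hf, rfl⟩
  exact ⟨glMap (2 * m) g f, invIdeal_stable ν g hg f hf, (Phi_lact g f).symm⟩

theorem DD_le {m l t : ℕ} (hl1 : 1 ≤ l) (hl : l < m) (ν : ℕ → ℕ) (hν : IsPartition m ν)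
    (hνl : ∀ i, i ≤ l → ν i = ν 0) :
    DD m l t ν ≤ ((invIdeal (2 * m) ν).restrictScalars ℂ).map (Phi m l (tailsum m l ν)) := by
  apply key_lemma
  · intro g hg p hp c hc
    have h1 := Phi_stable ν g hg _ (hp (glMap (2 * m) g⁻¹ c) (mIdeal_glMap _ _ _ hc))
    rw [map_mul, th0_lact, glMap_glMap, Matrix.nonsing_inv_mul _ hg, glMap_one] at h1
    exact h1
  · exact Phi_stable ν
  · intro v hv lam hlam
    have hρ : IsPartition m (rect l t) := rect_part hl.le
    obtain ⟨f, hf, hfe⟩ := hv _ (hw_rect_mem hl1 hl t)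
    have hth : th0 m l (hwVector (2 * m) (rect l t)) ≠ 0 := by
      have := Phi_hw_ne (l := l) _ hρ
      have h0 : tailsum m l (rect l t) = 0 := by
        apply Finset.sum_eq_zero
        intro k _
        simp only [rect]
        split_ifs <;> omega
      rwa [h0, Phi_apply, ← th0_eq] at this
    have hu : IsHW (th0 m l (hwVector (2 * m) (rect l t)) * v) (fun i => rect l t (i.1 / 2) + lam i) := by
      refine ⟨mul_ne_zero hth hlam.1, ?_, ?_⟩
      · intro i j hij
        have h1 := hlam.2.1 hij
        have h2 := hρ.1 (i.1 / 2) (j.1 / 2) (Nat.div_le_div_right (Fin.le_def.1 hij))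
        simp only
        omega
      · intro b hb
        rw [map_mul, th0_lact, glMap_hw b hb.1 _ hρ, map_smul, hlam.2.2 b hb, smul_mul_smul_comm,
          ← Finset.prod_mul_distrib]
        simp only [pow_add]
    obtain ⟨y, hy, hyν, hay, c, hc⟩ := hw_quot ν hν _ _ hu f hf hfe
    obtain ⟨w, hw⟩ : ∃ w : ℕ → ℕ, w = fun i => y i - rect l t i - ν i := ⟨_, rfl⟩
    have hyl : ∀ k, (hk : k < m) → y k = rect l t k + lam ⟨2 * k, by omega⟩ := by
      intro k hk
      have := hay ⟨2 * k, by omega⟩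
      simp only at this
      rw [Nat.mul_div_cancel_left k (by norm_num)] at this
      exact this.symm
    have hr1 : ∀ k, k < l → rect l t k = t := fun k hk => by simp [rect, hk]
    have hr2 : ∀ k, l ≤ k → rect l t k = 0 := fun k hk => by simp only [rect]; rw [if_neg (by omega)]
    have hlow : ∀ k, k < l → t + ν 0 ≤ y k := by
      intro k hk
      have h1 := hyl k (by omega)
      have h2 := hyl l hl
      have h3 : lam ⟨2 * l, by omega⟩ ≤ lam ⟨2 * k, by omega⟩ :=
        hlam.2.1 (Fin.le_def.2 (by simp only; omega))
      have h4 := hyν l le_rfl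
      have h5 := hνl l le_rfl
      have h6 := hr1 k hk
      have h7 := hr2 l le_rfl
      omega
    have hwl : ∀ k, k < l → w k + t + ν 0 = y k := by
      intro k hk
      have h1 := hlow k hk
      have h2 := hr1 k hk
      have h3 := hνl k hk.le
      simp only [hw]
      omega
    have hwg : ∀ k, l ≤ k → w k = 0 := by
      intro k hk
      simp only [hw]
      rw [hyν k hk]; omega
    have hwp : IsPartition m w := by
      refine ⟨?_, fun i hi => hwg i (by omega)⟩
      intro i j hij
      by_cases hj : j < l
      · have h1 := hwl i (by omega)
        have h2 := hwl j hj
        have h3 := hy.1 i j hij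
        omega
      · rw [hwg j (by omega)]; omega
    have hsum : y = fun i => rect l t i + (fun i => ν i + w i) i := by
      funext k
      by_cases hk : k < l
      · have h1 := hwl k hk
        have h2 := hr1 k hk
        have h3 := hνl k hk.le
        simp only
        omega
      · have h1 := hwg k (by omega)
        have h2 := hr2 k (by omega)
        have h3 := hyν k (by omega)
        simp only
        omega
    have hνw : IsPartition m (fun i => ν i + w i) := by
      refine ⟨fun i j hij => ?_, fun i hi => ?_⟩
      · have h1 := hν.1 i j hij
        have h2 := hwp.1 i j hij
        simp only
        omega
      · simp only
        rw [hν.2 i hi, hwp.2 i hi]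
    have hI : hwVector (2 * m) (fun i => ν i + w i) ∈ invIdeal (2 * m) ν := by
      rw [hw_add _ _ hν hwp]
      exact Ideal.mul_mem_right _ _ (hw_mem ν)
    rw [hsum, hw_add _ _ hρ hνw, Phi_mul ν hν _ _ hI, ← mul_smul_comm] at hc
    rw [mul_left_cancel₀ hth hc]
    exact Submodule.smul_mem _ _ ⟨_, hI, rfl⟩

theorem JMod_mk_eq {m l : ℕ} (ν : ℕ → ℕ) (f g : invIdeal (2 * m) ν)
    (h : (f : PS (2 * m)) - g ∈ succIdeal (2 * m) ν l) :
    (Submodule.Quotient.mk f : JMod (2 * m) ν l) = Submodule.Quotient.mk g := by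
  rw [Submodule.Quotient.eq]
  exact h

theorem JMod_mk_eq' {m l : ℕ} (ν : ℕ → ℕ) (f g : invIdeal (2 * m) ν)
    (h : (Submodule.Quotient.mk f : JMod (2 * m) ν l) = Submodule.Quotient.mk g) :
    (f : PS (2 * m)) - g ∈ succIdeal (2 * m) ν l := by
  rw [Submodule.Quotient.eq] at h
  exact h

theorem crit_zero {m : ℕ} (ν : ℕ → ℕ) (hν : IsPartition m ν) (t : ℕ)
    (φ : (mIdeal (2 * m) ^ t : Ideal (PS (2 * m))) →ₗ[PS (2 * m)] JMod (2 * m) ν 0) (x : PS (2 * m))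
    (hx : x ∈ mIdeal (2 * m) ^ (t + 1)) :
    φ ⟨x, Ideal.pow_le_pow_right (Nat.le_succ t) hx⟩ = 0 := by
  have key : ∀ (a : PS (2 * m)), a ∈ mIdeal (2 * m) → ∀ z : JMod (2 * m) ν 0, a • z = 0 := by
    intro a ha z
    obtain ⟨f, rfl⟩ := Submodule.Quotient.mk_surjective _ z
    rw [← Submodule.Quotient.mk_smul, Submodule.Quotient.mk_eq_zero]
    show a * (f : PS (2 * m)) ∈ succIdeal (2 * m) ν 0
    apply Phi_inj ν hν _ (Ideal.mul_mem_left _ _ f.2)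
    rw [Phi_mul ν hν _ _ f.2, th0_zero a ha, zero_mul]
  have hx' : x ∈ mIdeal (2 * m) * mIdeal (2 * m) ^ t := by rw [← pow_succ']; exact hx
  have main : ∃ h : x ∈ mIdeal (2 * m) ^ t, φ ⟨x, h⟩ = 0 := by
    induction hx' using Submodule.mul_induction_on' with
    | mem_mul_mem a ha b hb =>
      refine ⟨Ideal.mul_mem_left _ a hb, ?_⟩
      have h1 := φ.map_smul a ⟨b, hb⟩
      rw [key a ha] at h1
      exact h1
    | add a ha b hb iha ihb =>
      obtain ⟨h1, h1'⟩ := iha (by rw [pow_succ']; exact ha)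
      obtain ⟨h2, h2'⟩ := ihb (by rw [pow_succ']; exact hb)
      refine ⟨Ideal.add_mem _ h1 h2, ?_⟩
      have h3 := φ.map_add ⟨a, h1⟩ ⟨b, h2⟩
      rw [h1', h2', add_zero] at h3
      exact h3
  obtain ⟨h, h'⟩ := main
  exact h'

theorem crit_pos {m l : ℕ} (hl1 : 1 ≤ l) (hl : l < m) (ν : ℕ → ℕ) (hν : IsPartition m ν)
    (hνl : ∀ i, i ≤ l → ν i = ν 0) (t : ℕ)
    (φ : (mIdeal (2 * m) ^ t : Ideal (PS (2 * m))) →ₗ[PS (2 * m)] JMod (2 * m) ν l) :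
    ∃ y : JMod (2 * m) ν l, ∀ c, φ c = (c : PS (2 * m)) • y := by
  choose F hF using fun c => Submodule.Quotient.mk_surjective _ (φ c)
  have hcomm : ∀ c d : (mIdeal (2 * m) ^ t : Ideal (PS (2 * m))),
      th0 m l d * Phi m l (tailsum m l ν) (F c) = th0 m l c * Phi m l (tailsum m l ν) (F d) := by
    intro c d
    rw [← Phi_mul ν hν _ _ (F c).2, ← Phi_mul ν hν _ _ (F d).2, ← sub_eq_zero, ← map_sub]
    apply Phi_succ
    apply JMod_mk_eq' ν ((d : PS (2 * m)) • F c) ((c : PS (2 * m)) • F d)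
    rw [Submodule.Quotient.mk_smul, Submodule.Quotient.mk_smul, hF, hF, ← map_smul, ← map_smul]
    congr 1
    apply Subtype.ext
    exact mul_comm _ _
  let p01 : SkewIdx (2 * m) := ⟨(⟨0, by omega⟩, ⟨1, by omega⟩), by simp [Fin.lt_def]⟩
  let p23 : SkewIdx (2 * m) := ⟨(⟨2, by omega⟩, ⟨3, by omega⟩), by simp [Fin.lt_def]⟩
  let a : (mIdeal (2 * m) ^ t : Ideal (PS (2 * m))) := ⟨MvPolynomial.X p01 ^ t, Ideal.pow_mem_pow (X_mem _) t⟩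
  let b : (mIdeal (2 * m) ^ t : Ideal (PS (2 * m))) := ⟨MvPolynomial.X p23 ^ t, Ideal.pow_mem_pow (X_mem _) t⟩
  have ha0 : th0 m l a ≠ 0 := by
    simp only [a, map_pow]
    exact pow_ne_zero _ (th0_X_ne hl1 (by omega) _)
  have hrel : IsRelPrime (th0 m l a) (th0 m l b) := by
    simp only [a, b, map_pow]
    apply IsRelPrime.pow
    apply relprime_aux _ _ (th0_X_ne hl1 (by omega) _) (th0_X_ne hl1 (by omega) _)
    intro i
    by_cases h : i.1.1 < 2
    · right
      apply th0_X_deg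
      · intro he; rw [he] at h; simp [p23] at h
      · intro he; rw [he] at h; simp [p23] at h
    · left
      apply th0_X_deg
      · intro he; rw [he] at h; simp [p01] at h
      · intro he; rw [he] at h; simp [p01] at h
  obtain ⟨p, hp⟩ : th0 m l a ∣ Phi m l (tailsum m l ν) (F a) :=
    hrel.dvd_of_dvd_mul_left ⟨_, hcomm a b⟩
  have hpc : ∀ c, Phi m l (tailsum m l ν) (F c) = th0 m l c * p := by
    intro c
    apply mul_left_cancel₀ ha0
    rw [hcomm c a, hp]
    ring
  have hpD : p ∈ DD m l t ν := by
    intro c hc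
    exact ⟨F ⟨c, hc⟩, (F ⟨c, hc⟩).2, hpc ⟨c, hc⟩⟩
  obtain ⟨f0, hf0, hf0p⟩ := DD_le hl1 hl ν hν hνl hpD
  refine ⟨Submodule.Quotient.mk ⟨f0, hf0⟩, fun c => ?_⟩
  rw [← hF c, ← Submodule.Quotient.mk_smul]
  apply JMod_mk_eq
  apply Phi_inj ν hν _ (Ideal.sub_mem _ (F c).2 (Submodule.smul_mem _ _ hf0))
  rw [map_sub, smul_eq_mul, Phi_mul ν hν _ _ hf0, hf0p, hpc, sub_self]

end SkewLC

namespace SkewLC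

open CategoryTheory

/-- Let `n = 2m` be even.  If `0 ≤ l ≤ m-1` and `ν` is a
partition with at most `m` parts (recorded 0-indexed, so `ν i` is the
`(i+1)`-st part) satisfying `ν_1 = ⋯ = ν_{l+1}`, then
`H^1_{{0}}(J_{ν,l}) = 0`, where `J_{ν,l} = I_ν / I_{succ(ν,l,m)}`
(`JMod n ν l`). -/
theorem localCohomology_one_JMod_eq_zero
    (m : ℕ) (hm : 1 ≤ m) (n : ℕ) (hn : n = 2 * m)
    (l : ℕ) (hl : l < m) (ν : ℕ → ℕ) (hν : IsPartition m ν)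
    (hνl : ∀ i, i ≤ l → ν i = ν 0) :
    Subsingleton
      ((localCohomology (mIdeal n) 1).obj (ModuleCat.of (PS n) (JMod n ν l))) := by
  subst hn
  apply localCohomology_one_subsingleton
  intro t φ
  rcases Nat.eq_zero_or_pos l with h0 | h0
  · subst h0
    refine ⟨0, fun x hx => ?_⟩
    rw [smul_zero]
    exact crit_zero ν hν t φ x hx
  · obtain ⟨y, hy⟩ := crit_pos h0 hl ν hν hνl t φ
    exact ⟨y, fun x hx => hy _⟩

end SkewLC
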